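/- Upper bound for the rescaled solution: let m ∈ (m_s, 1), let u be a radial energy solution of the fast diffusion equation with exponent m and extinction time T > 0, and let w be its rescaled solution. Then for every ε > 0 there exists a constant Q′ > 0 such that w(r,τ) ≤ Q′ e^{−(N−1)r/m} for all r ≥ 0 and all τ ≥ ε. -/

import Mathlib

open MeasureTheory Set Filter Topology

/-- Membership in the radial energy space `H¹_rad` on hyperbolic space `ℍ^N`:
`v` is locally absolutely continuous on `(0,∞)` (expressed via the fundamental theorem
of calculus for its a.e. derivative) and both `v` and `v'` are square-integrable with
respect to the weight `(sinh s)^(N-1)`. -/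
def MemH1rad (N : ℕ) (v : ℝ → ℝ) : Prop :=
  (∀ a b : ℝ, 0 < a → a ≤ b → v b - v a = ∫ s in a..b, deriv v s) ∧
  MeasureTheory.IntegrableOn (fun s => (v s) ^ 2 * Real.sinh s ^ (N - 1)) (Set.Ioi 0) ∧
  MeasureTheory.IntegrableOn (fun s => (deriv v s) ^ 2 * Real.sinh s ^ (N - 1)) (Set.Ioi 0)

/-- The squared `H¹` norm `‖v‖_2² + ‖v'‖_2²` with weight `(sinh s)^(N-1)`. -/
noncomputable def H1normSq (N : ℕ) (v : ℝ → ℝ) : ℝ :=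
  (∫ s in Set.Ioi (0:ℝ), (v s) ^ 2 * Real.sinh s ^ (N - 1)) +
  (∫ s in Set.Ioi (0:ℝ), (deriv v s) ^ 2 * Real.sinh s ^ (N - 1))

/-- A radial energy solution of the fast diffusion equation `u_t = Δ(u^m)` on `ℍ^N`,
with exponent `m`, extinction time `T` (initial datum `u(·,0)`). -/
structure IsRadialEnergySolution (N : ℕ) (m T : ℝ) (u : ℝ → ℝ → ℝ) : Prop where
  continuousOn : ContinuousOn (fun p : ℝ × ℝ => u p.1 p.2) (Set.Ici 0 ×ˢ Set.Icc 0 T)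
  nonneg : ∀ r ∈ Set.Ici (0:ℝ), ∀ t ∈ Set.Icc (0:ℝ) T, 0 ≤ u r t
  smooth : ContDiffOn ℝ (⊤ : ℕ∞) (fun p : ℝ × ℝ => u p.1 p.2) (Set.Ici 0 ×ˢ Set.Ioo 0 T)
  pos : ∀ r ∈ Set.Ici (0:ℝ), ∀ t ∈ Set.Ioo (0:ℝ) T, 0 < u r t
  pde : ∀ r > (0:ℝ), ∀ t ∈ Set.Ioo (0:ℝ) T,
    deriv (fun τ => u r τ) t
      = deriv (deriv (fun ρ => u ρ t ^ m)) r
        + ((N : ℝ) - 1) * (Real.cosh r / Real.sinh r) * deriv (fun ρ => u ρ t ^ m) r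
  neumann : ∀ t ∈ Set.Ioo (0:ℝ) T, deriv (fun ρ => u ρ t ^ m) 0 = 0
  extinction : ∀ r ∈ Set.Ici (0:ℝ), u r T = 0
  energy : ∀ t ∈ Set.Ioo (0:ℝ) T, MemH1rad N (fun ρ => u ρ t ^ m)
  energy_bdd : ∀ ε ∈ Set.Ioo (0:ℝ) T, ∃ C : ℝ, ∀ t ∈ Set.Ico ε T,
    H1normSq N (fun ρ => u ρ t ^ m) ≤ C
  init_bdd : ∃ M : ℝ, ∀ r ∈ Set.Ici (0:ℝ), u r 0 ≤ M
  init_nonzero : ∃ r ∈ Set.Ici (0:ℝ), u r 0 ≠ 0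
  init_energy : MemH1rad N (fun ρ => u ρ 0 ^ m)

/-- The rescaled solution `w(r,τ) = e^{τ/((1-m)T)} u(r, T - T e^{-τ/T})`. -/
noncomputable def rescaled (m T : ℝ) (u : ℝ → ℝ → ℝ) (r τ : ℝ) : ℝ :=
  Real.exp (τ / ((1 - m) * T)) * u r (T - T * Real.exp (-τ / T))


structure Pk (n : ℕ) (m T : ℝ) (U vr ut : ℝ → ℝ → ℝ) : Prop where
  hn : 1 ≤ n
  hm0 : 0 < m
  hm1 : m < 1
  hT : 0 < T
  cont : Continuous (fun p : ℝ × ℝ => U p.1 p.2)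
  nonneg : ∀ r t, 0 ≤ U r t
  pos : ∀ r, ∀ t ∈ Ioo 0 T, 0 < U r t
  ext : ∀ r, U r T = 0
  vrc : ContinuousOn (fun p : ℝ × ℝ => vr p.1 p.2) (Ici 0 ×ˢ Ioo 0 T)
  utc : ContinuousOn (fun p : ℝ × ℝ => ut p.1 p.2) (Ici 0 ×ˢ Ioo 0 T)
  hv : ∀ r > 0, ∀ t ∈ Ioo 0 T, HasDerivAt (fun r => U r t ^ m) (vr r t) r
  hflux : ∀ r > 0, ∀ t ∈ Ioo 0 T,
    HasDerivAt (fun r => Real.sinh r ^ n * vr r t) (Real.sinh r ^ n * ut r t) r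
  hut : ∀ r ≥ 0, ∀ t ∈ Ioo 0 T, HasDerivAt (fun t => U r t) (ut r t) t
  decay : ∀ t0 ∈ Ioo 0 T, ∃ C, ∀ t ∈ Ico t0 T, ∀ r > 0, (U r t ^ m) ^ 2 * Real.sinh r ^ n ≤ C

noncomputable def PkM (n : ℕ) (U : ℝ → ℝ → ℝ) (r t : ℝ) : ℝ :=
  ∫ s in (0:ℝ)..r, Real.sinh s ^ n * U s t

noncomputable def PkW (m T : ℝ) (U : ℝ → ℝ → ℝ) (r t : ℝ) : ℝ :=
  ∫ s in t..T, U r s ^ m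

namespace Pk
variable {n : ℕ} {m T : ℝ} {U vr ut : ℝ → ℝ → ℝ}

lemma contV (h : Pk n m T U vr ut) : Continuous (fun p : ℝ × ℝ => U p.1 p.2 ^ m) :=
  h.cont.rpow_const (fun _ => Or.inr h.hm0.le)

lemma contM (h : Pk n m T U vr ut) : Continuous (fun p : ℝ × ℝ => PkM n U p.1 p.2) := by
  unfold PkM
  have h1 : Continuous (Function.uncurry (fun (p : ℝ × ℝ) (s : ℝ) => Real.sinh s ^ n * U s p.2)) := by
    have := h.cont.comp (g := fun p : ℝ × ℝ => U p.1 p.2)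
      (f := fun q : (ℝ × ℝ) × ℝ => (q.2, q.1.2)) (by fun_prop)
    have h2 : Continuous (fun q : (ℝ × ℝ) × ℝ => Real.sinh q.2 ^ n) := by fun_prop
    exact h2.mul this
  exact intervalIntegral.continuous_parametric_intervalIntegral_of_continuous h1 continuous_fst

lemma contW (h : Pk n m T U vr ut) : Continuous (fun p : ℝ × ℝ => PkW m T U p.1 p.2) := by
  unfold PkW
  have h1 : Continuous (Function.uncurry (fun (p : ℝ × ℝ) (s : ℝ) => U p.1 s ^ m)) := by
    exact h.contV.comp (g := fun p : ℝ × ℝ => U p.1 p.2 ^ m)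
      (f := fun q : (ℝ × ℝ) × ℝ => (q.1.1, q.2)) (by fun_prop)
  have := intervalIntegral.continuous_parametric_intervalIntegral_of_continuous (μ := volume)
    (a₀ := T) h1 continuous_snd
  have h3 := this.neg
  refine h3.congr fun p => ?_
  rw [intervalIntegral.integral_symm]; simp

lemma cV1 (h : Pk n m T U vr ut) (r : ℝ) : Continuous (fun t => U r t ^ m) :=
  h.contV.comp (g := fun p : ℝ × ℝ => U p.1 p.2 ^ m) (f := fun t => (r, t)) (by fun_prop)

lemma cU2 (h : Pk n m T U vr ut) (t : ℝ) : Continuous (fun r => U r t) :=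
  h.cont.comp (g := fun p : ℝ × ℝ => U p.1 p.2) (f := fun r => (r, t)) (by fun_prop)

lemma cV2 (h : Pk n m T U vr ut) (t : ℝ) : Continuous (fun r => U r t ^ m) :=
  h.contV.comp (g := fun p : ℝ × ℝ => U p.1 p.2 ^ m) (f := fun r => (r, t)) (by fun_prop)

lemma cM1 (h : Pk n m T U vr ut) (t : ℝ) : Continuous (fun r => PkM n U r t) :=
  h.contM.comp (g := fun p : ℝ × ℝ => PkM n U p.1 p.2) (f := fun r => (r, t)) (by fun_prop)

lemma cW1 (h : Pk n m T U vr ut) (t : ℝ) : Continuous (fun r => PkW m T U r t) :=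
  h.contW.comp (g := fun p : ℝ × ℝ => PkW m T U p.1 p.2) (f := fun r => (r, t)) (by fun_prop)

lemma cW2 (h : Pk n m T U vr ut) (r : ℝ) : Continuous (fun t => PkW m T U r t) :=
  h.contW.comp (g := fun p : ℝ × ℝ => PkW m T U p.1 p.2) (f := fun t => (r, t)) (by fun_prop)

lemma derivM (h : Pk n m T U vr ut) (r t : ℝ) :
    HasDerivAt (fun r => PkM n U r t) (Real.sinh r ^ n * U r t) r := by
  have hc : Continuous fun s => Real.sinh s ^ n * U s t :=
    (Real.continuous_sinh.pow n).mul (h.cU2 t)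
  exact intervalIntegral.integral_hasDerivAt_right (hc.intervalIntegrable _ _)
    (hc.stronglyMeasurableAtFilter _ _) hc.continuousAt

lemma flux (h : Pk n m T U vr ut) {t : ℝ} (ht : t ∈ Ioo 0 T) {r : ℝ} (hr : 0 ≤ r) :
    Real.sinh r ^ n * vr r t = ∫ s in (0:ℝ)..r, Real.sinh s ^ n * ut s t := by
  have c1 : ContinuousOn (fun s => vr s t) (Ici 0) :=
    h.vrc.comp (f := fun s => (s, t)) (by fun_prop) (fun s hs => ⟨hs, ht⟩)
  have c2 : ContinuousOn (fun s => ut s t) (Ici 0) :=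
    h.utc.comp (f := fun s => (s, t)) (by fun_prop) (fun s hs => ⟨hs, ht⟩)
  have cs : Continuous fun s => Real.sinh s ^ n := Real.continuous_sinh.pow n
  have := intervalIntegral.integral_eq_sub_of_hasDerivAt_of_le (a := 0) (b := r)
    (f := fun s => Real.sinh s ^ n * vr s t) (f' := fun s => Real.sinh s ^ n * ut s t) hr
    ((cs.continuousOn.mul c1).mono Icc_subset_Ici_self)
    (fun x hx => h.hflux x hx.1 t ht)
    (((cs.continuousOn.mul c2).mono (by rw [uIcc_of_le hr]; exact Icc_subset_Ici_self)).intervalIntegrable)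
  rw [this]
  have hn := h.hn
  simp [show n ≠ 0 by omega]

lemma swapc {F : ℝ → ℝ → ℝ} {a b c d : ℝ} (hab : a ≤ b) (hcd : c ≤ d)
    (hF : ContinuousOn (fun p : ℝ × ℝ => F p.1 p.2) (Icc a b ×ˢ Icc c d)) :
    ∫ x in a..b, ∫ y in c..d, F x y = ∫ y in c..d, ∫ x in a..b, F x y := by
  apply MeasureTheory.intervalIntegral_intervalIntegral_swap
  rw [uIoc_of_le hab, uIoc_of_le hcd]
  have := hF.integrableOn_compact (μ := volume) (isCompact_Icc.prod isCompact_Icc)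
  exact this.mono_set (prod_mono Ioc_subset_Icc_self Ioc_subset_Icc_self)

lemma fluxM (h : Pk n m T U vr ut) {t1 t2 : ℝ} (h1 : 0 < t1) (h12 : t1 ≤ t2) (h2 : t2 < T)
    {r : ℝ} (hr : 0 ≤ r) :
    ∫ t in t1..t2, Real.sinh r ^ n * vr r t = PkM n U r t2 - PkM n U r t1 := by
  have hsub : Icc t1 t2 ⊆ Ioo 0 T := fun t ht => ⟨h1.trans_le ht.1, ht.2.trans_lt h2⟩
  have e1 : ∫ t in t1..t2, Real.sinh r ^ n * vr r t
      = ∫ t in t1..t2, ∫ s in (0:ℝ)..r, Real.sinh s ^ n * ut s t := by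
    apply intervalIntegral.integral_congr
    intro t ht
    rw [uIcc_of_le h12] at ht
    exact h.flux (hsub ht) hr
  have e2 := swapc (F := fun t s => Real.sinh s ^ n * ut s t) h12 hr (by
    have c2 : ContinuousOn (fun p : ℝ × ℝ => ut p.2 p.1) (Icc t1 t2 ×ˢ Icc 0 r) :=
      h.utc.comp (f := fun p : ℝ × ℝ => (p.2, p.1)) (by fun_prop)
        (fun p hp => ⟨hp.2.1, hsub hp.1⟩)
    have c3 : Continuous (fun p : ℝ × ℝ => Real.sinh p.2 ^ n) := by fun_prop
    exact c3.continuousOn.mul c2)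
  rw [e1, e2]
  unfold PkM
  have cs : ∀ t, Continuous fun s => Real.sinh s ^ n * U s t := fun t =>
    (Real.continuous_sinh.pow n).mul (h.cU2 t)
  rw [← intervalIntegral.integral_sub ((cs t2).intervalIntegrable _ _)
    ((cs t1).intervalIntegrable _ _)]
  apply intervalIntegral.integral_congr
  intro s hs
  rw [uIcc_of_le hr] at hs
  simp only
  rw [intervalIntegral.integral_const_mul, ← mul_sub]
  congr 1
  apply intervalIntegral.integral_eq_sub_of_hasDerivAt
  · intro t ht
    rw [uIcc_of_le h12] at ht
    exact h.hut s hs.1 t (hsub ht)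
  · apply ContinuousOn.intervalIntegrable
    rw [uIcc_of_le h12]
    exact h.utc.comp (f := fun t => (s, t)) (by fun_prop) (fun t ht => ⟨hs.1, hsub ht⟩)

lemma sinhn_pos {r : ℝ} (hr : 0 < r) : 0 < Real.sinh r ^ n :=
  pow_pos (Real.sinh_pos_iff.2 hr) n

lemma Wdiff0 (h : Pk n m T U vr ut) {t1 t2 : ℝ} (h1 : 0 < t1) (h12 : t1 ≤ t2) (h2 : t2 < T)
    {a b : ℝ} (ha : 0 < a) (hab : a ≤ b) :
    ∫ t in t1..t2, (U b t ^ m - U a t ^ m)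
      = ∫ s in a..b, (PkM n U s t2 - PkM n U s t1) / Real.sinh s ^ n := by
  have hsub : Icc t1 t2 ⊆ Ioo 0 T := fun t ht => ⟨h1.trans_le ht.1, ht.2.trans_lt h2⟩
  have e1 : ∫ t in t1..t2, (U b t ^ m - U a t ^ m)
      = ∫ t in t1..t2, ∫ s in a..b, vr s t := by
    apply intervalIntegral.integral_congr
    intro t ht
    rw [uIcc_of_le h12] at ht
    symm
    apply intervalIntegral.integral_eq_sub_of_hasDerivAt
    · intro s hs
      rw [uIcc_of_le hab] at hs
      exact h.hv s (ha.trans_le hs.1) t (hsub ht)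
    · apply ContinuousOn.intervalIntegrable
      rw [uIcc_of_le hab]
      exact h.vrc.comp (f := fun s => (s, t)) (by fun_prop)
        (fun s hs => ⟨ha.le.trans hs.1, hsub ht⟩)
  have e2 := swapc (F := fun t s => vr s t) h12 hab (
      h.vrc.comp (f := fun p : ℝ × ℝ => (p.2, p.1)) (by fun_prop)
        (fun p hp => ⟨ha.le.trans hp.2.1, hsub hp.1⟩))
  rw [e1, e2]
  apply intervalIntegral.integral_congr
  intro s hs
  rw [uIcc_of_le hab] at hs
  have hs0 : 0 < s := ha.trans_le hs.1
  have := h.fluxM h1 h12 h2 hs0.le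
  rw [intervalIntegral.integral_const_mul] at this
  simp only
  rw [← this]
  field_simp [(sinhn_pos (n := n) hs0).ne']

lemma M_T (h : Pk n m T U vr ut) (r : ℝ) : PkM n U r T = 0 := by
  simp [PkM, h.ext]

lemma Wdiff (h : Pk n m T U vr ut) {t1 : ℝ} (h1 : t1 ∈ Ioo 0 T)
    {a b : ℝ} (ha : 0 < a) (hab : a ≤ b) :
    PkW m T U b t1 - PkW m T U a t1 = ∫ s in a..b, -(PkM n U s t1 / Real.sinh s ^ n) := by
  have c1 : Continuous fun t2 => ∫ t in t1..t2, (U b t ^ m - U a t ^ m) :=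
    intervalIntegral.continuous_primitive (fun x y =>
      ((h.cV1 b).sub (h.cV1 a)).intervalIntegrable x y) t1
  have c2 : Continuous fun t2 => ∫ s in a..b,
      (PkM n U s t2 - PkM n U s t1) / Real.sinh (max s a) ^ n := by
    apply intervalIntegral.continuous_parametric_intervalIntegral_of_continuous'
    have e1 : Continuous fun p : ℝ × ℝ => PkM n U p.2 p.1 :=
      h.contM.comp (g := fun p : ℝ × ℝ => PkM n U p.1 p.2) (f := fun p : ℝ × ℝ => (p.2, p.1)) (by fun_prop)
    have e2 : Continuous fun p : ℝ × ℝ => PkM n U p.2 t1 :=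
      h.contM.comp (g := fun p : ℝ × ℝ => PkM n U p.1 p.2) (f := fun p : ℝ × ℝ => (p.2, t1)) (by fun_prop)
    refine (e1.sub e2).div (by fun_prop) fun p => ?_
    exact (sinhn_pos (lt_max_of_lt_right ha)).ne'
  have hh : ∀ t2, (∫ s in a..b, (PkM n U s t2 - PkM n U s t1) / Real.sinh (max s a) ^ n)
      = ∫ s in a..b, (PkM n U s t2 - PkM n U s t1) / Real.sinh s ^ n := by
    intro t2
    apply intervalIntegral.integral_congr
    intro s hs
    rw [uIcc_of_le hab] at hs
    simp only [max_eq_left hs.1]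
  have hT : (∫ t in t1..T, (U b t ^ m - U a t ^ m)) = ∫ s in a..b,
      (PkM n U s T - PkM n U s t1) / Real.sinh (max s a) ^ n := by
    have l1 := (c1.tendsto T).mono_left (nhdsWithin_le_nhds (s := Iio T))
    have l2 := (c2.tendsto T).mono_left (nhdsWithin_le_nhds (s := Iio T))
    refine tendsto_nhds_unique l1 (l2.congr' ?_)
    filter_upwards [Ioo_mem_nhdsLT h1.2] with t2 ht2
    rw [hh, h.Wdiff0 h1.1 ht2.1.le ht2.2 ha hab]
  rw [hh, intervalIntegral.integral_sub ((h.cV1 b).intervalIntegrable _ _)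
    ((h.cV1 a).intervalIntegrable _ _)] at hT
  unfold PkW
  rw [hT]
  apply intervalIntegral.integral_congr
  intro s _
  simp only [h.M_T]
  ring

lemma derivW (h : Pk n m T U vr ut) {t : ℝ} (ht : t ∈ Ioo 0 T) {r : ℝ} (hr : 0 < r) :
    HasDerivAt (fun r => PkW m T U r t) (-(PkM n U r t / Real.sinh r ^ n)) r := by
  have hc : ContinuousOn (fun s => -(PkM n U s t / Real.sinh s ^ n)) (Ioi 0) := by
    refine ((h.cM1 t).continuousOn.div (by fun_prop) fun s hs => ?_).neg
    exact (sinhn_pos hs).ne'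
  have h2 : (0:ℝ) < r / 2 := by linarith
  have key : HasDerivAt (fun x => ∫ s in (r/2)..x, -(PkM n U s t / Real.sinh s ^ n))
      (-(PkM n U r t / Real.sinh r ^ n)) r := by
    apply intervalIntegral.integral_hasDerivAt_right
    · apply (hc.mono _).intervalIntegrable
      rw [uIcc_of_le (by linarith)]
      intro x hx
      exact h2.trans_le hx.1
    · exact hc.stronglyMeasurableAtFilter isOpen_Ioi _ hr
    · exact hc.continuousAt (Ioi_mem_nhds hr)
  have k2 := key.const_add (PkW m T U (r/2) t)
  refine k2.congr_of_eventuallyEq ?_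
  filter_upwards [Ioi_mem_nhds (show r/2 < r by linarith)] with x hx
  have := h.Wdiff ht h2 (le_of_lt hx)
  linarith

end Pk

namespace Pk
variable {n : ℕ} {m T : ℝ} {U vr ut : ℝ → ℝ → ℝ}

lemma sinhn_le {r : ℝ} : Real.sinh r ^ n ≤ Real.exp (n * r) ∨ r < 0 := by
  by_cases hr : r < 0
  · exact Or.inr hr
  · left
    push Not at hr
    rw [Real.exp_nat_mul]
    apply pow_le_pow_left₀ (Real.sinh_nonneg_iff.2 hr)
    rw [Real.sinh_eq]
    linarith [Real.exp_pos r, Real.exp_pos (-r)]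

lemma sinhn_le' {r : ℝ} (hr : 0 ≤ r) : Real.sinh r ^ n ≤ Real.exp (n * r) :=
  (sinhn_le).resolve_right (not_lt.2 hr)

lemma le_sinhn {r : ℝ} (hr : 1 ≤ r) : Real.exp (n * r) / 4 ^ n ≤ Real.sinh r ^ n := by
  rw [Real.exp_nat_mul, ← div_pow]
  apply pow_le_pow_left₀ (by positivity)
  rw [Real.sinh_eq]
  have h1 : Real.exp (-r) ≤ 1 := Real.exp_le_one_iff.2 (by linarith)
  have h2 : r + 1 ≤ Real.exp r := Real.add_one_le_exp r
  linarith

lemma nonnegV (h : Pk n m T U vr ut) (r t : ℝ) : 0 ≤ U r t ^ m := Real.rpow_nonneg (h.nonneg r t) m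

lemma expdecay (h : Pk n m T U vr ut) {t0 : ℝ} (ht0 : t0 ∈ Ioo 0 T) :
    ∃ K > 0, ∀ r ≥ 0, ∀ t ∈ Icc t0 T, U r t ^ m ≤ K * Real.exp (-(n * r / 2)) := by
  obtain ⟨C, hC⟩ := h.decay t0 ht0
  obtain ⟨B, hB⟩ := ((isCompact_Icc (a := (0:ℝ)) (b := 1)).prod
    (isCompact_Icc (a := t0) (b := T))).bddAbove_image (f := fun p : ℝ × ℝ => U p.1 p.2 ^ m)
    h.contV.continuousOn
  have hB' : ∀ r ∈ Icc (0:ℝ) 1, ∀ t ∈ Icc t0 T, U r t ^ m ≤ B := fun r hr t ht =>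
    hB ⟨(r, t), ⟨hr, ht⟩, rfl⟩
  refine ⟨|B| * Real.exp (n / 2) + Real.sqrt (|C| * 4 ^ n) + 1, by positivity, ?_⟩
  intro r hr t ht
  have hs := Real.sqrt_nonneg (|C| * 4 ^ n)
  have he := Real.exp_pos (-(n * r / 2))
  rcases le_total r 1 with hr1 | hr1
  · have h1 := hB' r ⟨hr, hr1⟩ t ht
    have h2 : 1 ≤ Real.exp (n / 2) * Real.exp (-(n * r / 2)) := by
      rw [← Real.exp_add]
      apply Real.one_le_exp
      have : (n:ℝ) * r ≤ n * 1 := by gcongr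
      linarith
    calc U r t ^ m ≤ |B| := h1.trans (le_abs_self B)
      _ = |B| * 1 := by ring
      _ ≤ |B| * (Real.exp (n / 2) * Real.exp (-(n * r / 2))) := by gcongr
      _ ≤ _ := by nlinarith
  · rcases eq_or_lt_of_le ht.2 with rfl | htT
    · rw [h.ext, Real.zero_rpow h.hm0.ne']; positivity
    · have h1 := hC t ⟨ht.1, htT⟩ r (by linarith)
      have h2 := le_sinhn (n := n) hr1
      have h3 : (U r t ^ m) ^ 2 ≤ (|C| * 4 ^ n) * Real.exp (-(n * r / 2)) ^ 2 := by
        have h4 : (U r t ^ m) ^ 2 * (Real.exp (n * r) / 4 ^ n) ≤ |C| :=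
          (mul_le_mul_of_nonneg_left h2 (sq_nonneg _)).trans (h1.trans (le_abs_self C))
        have h5 : Real.exp (-(n * r / 2)) ^ 2 = (Real.exp (n * r))⁻¹ := by
          rw [← Real.exp_neg, sq, ← Real.exp_add]; congr 1; ring
        rw [h5, ← div_eq_mul_inv, le_div_iff₀ (Real.exp_pos _)]
        rw [← mul_div_assoc, div_le_iff₀ (by positivity)] at h4
        exact h4
      have h6 : U r t ^ m ≤ Real.sqrt (|C| * 4 ^ n) * Real.exp (-(n * r / 2)) := by
        apply le_of_sq_le_sq _ (by positivity)
        rw [mul_pow, Real.sq_sqrt (by positivity)]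
        exact h3
      calc _ ≤ _ := h6
        _ ≤ _ := by
          have : 0 ≤ |B| * Real.exp (n / 2) := by positivity
          apply mul_le_mul_of_nonneg_right _ he.le
          linarith

lemma W_anti_t (h : Pk n m T U vr ut) (r : ℝ) {t1 t2 : ℝ} (h12 : t1 ≤ t2) :
    PkW m T U r t2 ≤ PkW m T U r t1 := by
  unfold PkW
  rw [← intervalIntegral.integral_add_adjacent_intervals
    ((h.cV1 r).intervalIntegrable t1 t2) ((h.cV1 r).intervalIntegrable t2 T)]
  have := intervalIntegral.integral_nonneg (μ := volume) h12 (fun t _ => h.nonnegV r t)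
  linarith

lemma derivWt (h : Pk n m T U vr ut) (r t : ℝ) :
    HasDerivAt (fun t => PkW m T U r t) (-(U r t ^ m)) t :=
  intervalIntegral.integral_hasDerivAt_left ((h.cV1 r).intervalIntegrable _ _)
    ((h.cV1 r).stronglyMeasurableAtFilter _ _) (h.cV1 r).continuousAt

lemma deriv_nonneg_of_max {f : ℝ → ℝ} {f' a b : ℝ} (hab : a < b) (hf : HasDerivAt f f' b)
    (hmax : ∀ x ∈ Ico a b, f x ≤ f b) : 0 ≤ f' := by
  have h1 := (hasDerivWithinAt_iff_tendsto_slope' (s := Iio b) (by simp)).1 hf.hasDerivWithinAt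
  refine ge_of_tendsto h1 ?_
  filter_upwards [Ico_mem_nhdsLT hab] with x hx
  rw [slope_def_field]
  exact div_nonneg_of_nonpos (by linarith [hmax x hx]) (by linarith [hx.2])

lemma smoothing (h : Pk n m T U vr ut) {t0 t r : ℝ} (h0 : 0 < t0) (h0t : t0 < t) (htT : t < T)
    (hr : 0 ≤ r) :
    (1 - m) * (t - t0) * U r t ^ m ≤ PkW m T U r t0 - PkW m T U r t := by
  by_contra hcon
  push Not at hcon
  set F : ℝ → ℝ → ℝ := fun r s => (1 - m) * (s - t0) * U r s ^ m + PkW m T U r s - PkW m T U r t0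
    with hF
  have hm1 := h.hm1
  have hm0 := h.hm0
  have hFpos : 0 < F r t := by simp only [hF]; linarith
  have ht0 : t0 ∈ Ioo 0 T := ⟨h0, h0t.trans htT⟩
  obtain ⟨K, hK0, hK⟩ := h.expdecay ht0
  -- choose R
  have hlim : Tendsto (fun R : ℝ => T * (K * Real.exp (-(n * R / 2)))) atTop (𝓝 (T * (K * 0))) := by
    apply Tendsto.const_mul
    apply Tendsto.const_mul
    apply Real.tendsto_exp_neg_atTop_nhds_zero.comp
    have hn : (0:ℝ) < n := by exact_mod_cast h.hn
    have : Tendsto (fun R : ℝ => (n / 2 : ℝ) * R) atTop atTop :=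
      Tendsto.const_mul_atTop (by positivity) tendsto_id
    refine this.congr fun x => by ring
  rw [mul_zero, mul_zero] at hlim
  obtain ⟨R, hR1, hR2⟩ := ((hlim.eventually (gt_mem_nhds hFpos)).and
    (eventually_gt_atTop r)).exists
  have hR0 : 0 < R := hr.trans_lt hR2
  have hFcont : Continuous fun p : ℝ × ℝ => F p.1 p.2 := by
    have c1 := h.contV
    have c2 := h.contW
    have c3 : Continuous fun p : ℝ × ℝ => PkW m T U p.1 t0 :=
      h.contW.comp (g := fun p : ℝ × ℝ => PkW m T U p.1 p.2)
        (f := fun p : ℝ × ℝ => (p.1, t0)) (by fun_prop)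
    have c4 : Continuous fun p : ℝ × ℝ => (1 - m) * (p.2 - t0) := by fun_prop
    exact ((c4.mul c1).add c2).sub c3
  obtain ⟨⟨x, s⟩, ⟨hx, hs⟩, hmax⟩ := ((isCompact_Icc (a := (0:ℝ)) (b := R)).prod
    (isCompact_Icc (a := t0) (b := t))).exists_isMaxOn
    ⟨(r, t), ⟨⟨hr, hR2.le⟩, ⟨h0t.le, le_rfl⟩⟩⟩ hFcont.continuousOn
  have hmax' : ∀ y ∈ Icc 0 R, ∀ q ∈ Icc t0 t, F y q ≤ F x s := fun y hy q hq =>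
    hmax (show (y, q) ∈ Icc 0 R ×ˢ Icc t0 t from ⟨hy, hq⟩)
  simp only at hx hs
  have hxs : F r t ≤ F x s := hmax' r ⟨hr, hR2.le⟩ t ⟨h0t.le, le_rfl⟩
  have hst0 : t0 < s := by
    rcases eq_or_lt_of_le hs.1 with rfl | hlt
    · simp [hF] at hxs hFpos; linarith
    · exact hlt
  have hsT : s < T := hs.2.trans_lt htT
  have hsI : s ∈ Ioo 0 T := ⟨h0.trans hst0, hsT⟩
  have hxR : x < R := by
    rcases eq_or_lt_of_le hx.2 with rfl | hlt
    · exfalso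
      have h1 := hK x hR0.le s ⟨hst0.le, hsT.le⟩
      have h2 := h.W_anti_t x hst0.le
      have h3 : F x s ≤ (1 - m) * (s - t0) * U x s ^ m := by simp only [hF]; linarith
      have h4 : (1 - m) * (s - t0) * U x s ^ m ≤ T * (K * Real.exp (-(n * x / 2))) := by
        apply mul_le_mul _ h1 (h.nonnegV _ _) h.hT.le
        nlinarith
      linarith
    · exact hlt
  -- time derivative
  have hU := h.pos x s hsI
  have hdt : HasDerivAt (fun q => F x q) ((1 - m) * 1 * U x s ^ m
      + (1 - m) * (s - t0) * (ut x s * m * U x s ^ (m - 1)) + (-(U x s ^ m))) s := by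
    have d1 : HasDerivAt (fun q => (1 - m) * (q - t0)) ((1 - m) * 1) s :=
      ((hasDerivAt_id s).sub_const t0).const_mul (1 - m)
    have d2 := (h.hut x hx.1 s hsI).rpow_const (p := m) (Or.inl hU.ne')
    exact ((d1.mul d2).add (h.derivWt x s)).sub_const _
  have hdt0 := deriv_nonneg_of_max hst0 hdt (fun q hq => hmax' x hx q ⟨hq.1, hq.2.le.trans hs.2⟩)
  have hUU : U x s ^ m = U x s ^ (m - 1) * U x s := by
    rw [← Real.rpow_add_one hU.ne']; congr 1; ring
  have ha : 0 < U x s ^ (m - 1) := Real.rpow_pos_of_pos hU _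
  set D : ℝ → ℝ := fun y => (1 - m) * (s - t0) * ut y s - (U y s - U y t0) with hD
  have hDx : 0 < D x := by
    have h1 : 0 ≤ m * U x s ^ (m - 1) * ((1 - m) * (s - t0) * ut x s - U x s) := by
      rw [hUU] at hdt0
      linarith
    have h2 : 0 ≤ (1 - m) * (s - t0) * ut x s - U x s :=
      nonneg_of_mul_nonneg_right h1 (by positivity)
    have := h.pos x t0 ht0
    simp only [hD]; linarith
  have cut : ContinuousOn (fun y => ut y s) (Ici 0) :=
    h.utc.comp (f := fun y => (y, s)) (by fun_prop) (fun y hy => ⟨hy, hsI⟩)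
  have cvr : ContinuousOn (fun y => vr y s) (Ici 0) :=
    h.vrc.comp (f := fun y => (y, s)) (by fun_prop) (fun y hy => ⟨hy, hsI⟩)
  have cD : ContinuousOn D (Ici 0) :=
    (continuousOn_const.mul cut).sub ((h.cU2 s).sub (h.cU2 t0)).continuousOn
  have hev : ∀ᶠ y in 𝓝[≥] x, 0 < D y := by
    have : ContinuousWithinAt D (Ici x) x := (cD x hx.1).mono (Ici_subset_Ici.2 hx.1)
    exact this.eventually (lt_mem_nhds hDx)
  obtain ⟨b, hb1, hb2⟩ := (mem_nhdsGE_iff_exists_Icc_subset).1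
    (inter_mem hev (Icc_mem_nhdsGE hxR))
  have hbx : x < b := hb1
  have hbR : b ≤ R := (hb2 ⟨hbx.le, le_rfl⟩).2.2
  set P : ℝ → ℝ := fun y => (1 - m) * (s - t0) * (Real.sinh y ^ n * vr y s)
      - PkM n U y s + PkM n U y t0 with hP
  have dP : ∀ y > 0, HasDerivAt P (Real.sinh y ^ n * D y) y := by
    intro y hy
    have := (((h.hflux y hy s hsI).const_mul ((1 - m) * (s - t0))).sub (h.derivM y s)).add
      (h.derivM y t0)
    refine HasDerivAt.congr_deriv this ?_
    simp only [hD]; ring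
  have cP : ContinuousOn P (Ici 0) := by
    have cs : Continuous fun s => Real.sinh s ^ n := Real.continuous_sinh.pow n
    exact ((continuousOn_const.mul (cs.continuousOn.mul cvr)).sub (h.cM1 s).continuousOn).add
      (h.cM1 t0).continuousOn
  have dF : ∀ y > 0, HasDerivAt (fun y => F y s) (P y / Real.sinh y ^ n) y := by
    intro y hy
    have := (((h.hv y hy s hsI).const_mul ((1 - m) * (s - t0))).add (h.derivW hsI hy)).sub
      (h.derivW ht0 hy)
    refine HasDerivAt.congr_deriv this ?_
    have := (sinhn_pos (n := n) hy).ne'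
    simp only [hP]
    field_simp
    ring
  have hPx : P x = 0 := by
    rcases eq_or_lt_of_le hx.1 with h00 | hx0
    · have hn := h.hn
      simp [hP, ← h00, PkM, show n ≠ 0 by omega]
    · have hl : IsLocalMax (fun y => F y s) x := by
        filter_upwards [Ioo_mem_nhds hx0 hxR] with y hy
        exact hmax' y ⟨hy.1.le, hy.2.le⟩ s hs
      have := hl.hasDerivAt_eq_zero (dF x hx0)
      rcases div_eq_zero_iff.1 this with h1 | h1
      · exact h1
      · exact absurd h1 (sinhn_pos hx0).ne'
  have hsubI : Icc x b ⊆ Ici (0:ℝ) := fun y hy => hx.1.trans hy.1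
  have sP : StrictMonoOn P (Icc x b) := by
    apply strictMonoOn_of_deriv_pos (convex_Icc x b) (cP.mono hsubI)
    intro y hy
    rw [interior_Icc] at hy
    have hy0 : 0 < y := hx.1.trans_lt hy.1
    rw [(dP y hy0).deriv]
    exact mul_pos (sinhn_pos hy0) (hb2 ⟨hy.1.le, hy.2.le⟩).1
  have sF : StrictMonoOn (fun y => F y s) (Icc x b) := by
    apply strictMonoOn_of_deriv_pos (convex_Icc x b)
    · exact (hFcont.comp (g := fun p : ℝ × ℝ => F p.1 p.2) (f := fun y => (y, s))
        (by fun_prop)).continuousOn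
    intro y hy
    rw [interior_Icc] at hy
    have hy0 : 0 < y := hx.1.trans_lt hy.1
    rw [(dF y hy0).deriv]
    apply div_pos _ (sinhn_pos hy0)
    have := sP ⟨le_rfl, hbx.le⟩ ⟨hy.1.le, hy.2.le⟩ hy.1
    rwa [hPx] at this
  have h1 := sF ⟨le_rfl, hbx.le⟩ ⟨hbx.le, le_rfl⟩ hbx
  have h2 := hmax' b ⟨hx.1.trans hbx.le, hbR⟩ s hs
  simp only at h1
  linarith

end Pk

namespace Pk
variable {n : ℕ} {m T : ℝ} {U vr ut : ℝ → ℝ → ℝ}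

lemma U_eq (h : Pk n m T U vr ut) (r t : ℝ) : U r t = (U r t ^ m) ^ (1 / m) := by
  rw [← Real.rpow_mul (h.nonneg r t), mul_one_div_cancel h.hm0.ne', Real.rpow_one]

/-- decay of `U` from decay of `U^m` -/
lemma U_le (h : Pk n m T U vr ut) {r t K a : ℝ} (hK : 0 ≤ K)
    (hb : U r t ^ m ≤ K * Real.exp (-a)) : U r t ≤ K ^ (1 / m) * Real.exp (-(a / m)) := by
  rw [h.U_eq]
  have := Real.rpow_le_rpow (h.nonnegV r t) hb (z := 1 / m) (by have := h.hm0; positivity)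
  rw [Real.mul_rpow hK (Real.exp_pos _).le, ← Real.exp_mul] at this
  convert this using 3
  ring

lemma W_nonneg (h : Pk n m T U vr ut) (r : ℝ) {t : ℝ} (ht : t ≤ T) : 0 ≤ PkW m T U r t :=
  intervalIntegral.integral_nonneg ht (fun s _ => h.nonnegV r s)

lemma W_le (h : Pk n m T U vr ut) {r t B : ℝ} (ht : t ≤ T)
    (hB : ∀ s ∈ Icc t T, U r s ^ m ≤ B) : PkW m T U r t ≤ (T - t) * B := by
  have := intervalIntegral.integral_mono_on (μ := volume) ht ((h.cV1 r).intervalIntegrable t T)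
    (intervalIntegrable_const (c := B)) hB
  simpa [PkW] using this

lemma M_nonneg (h : Pk n m T U vr ut) {r : ℝ} (hr : 0 ≤ r) (t : ℝ) : 0 ≤ PkM n U r t :=
  intervalIntegral.integral_nonneg hr (fun s hs =>
    mul_nonneg (pow_nonneg (Real.sinh_nonneg_iff.2 hs.1) n) (h.nonneg s t))

lemma M_le (h : Pk n m T U vr ut) {r t B : ℝ} (hr : 0 ≤ r)
    (hB : ∀ s ∈ Icc 0 r, Real.sinh s ^ n * U s t ≤ B) : PkM n U r t ≤ r * B := by
  have hc : Continuous fun s => Real.sinh s ^ n * U s t :=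
    (Real.continuous_sinh.pow n).mul (h.cU2 t)
  have := intervalIntegral.integral_mono_on (μ := volume) hr (hc.intervalIntegrable 0 r)
    (intervalIntegrable_const (c := B)) hB
  simpa [PkM] using this

lemma W_anti_r (h : Pk n m T U vr ut) {t : ℝ} (ht : t ∈ Ioo 0 T) :
    AntitoneOn (fun r => PkW m T U r t) (Ici 0) := by
  apply antitoneOn_of_deriv_nonpos (convex_Ici 0) (h.cW1 t).continuousOn
  · intro r hr
    rw [interior_Ici] at hr
    exact (h.derivW ht hr).differentiableAt.differentiableWithinAt
  · intro r hr
    rw [interior_Ici] at hr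
    rw [(h.derivW ht hr).deriv]
    have := h.M_nonneg (le_of_lt hr) t
    have := sinhn_pos (n := n) hr
    simp only [Left.neg_nonpos_iff]
    positivity

noncomputable def kap (n : ℕ) (m : ℝ) : ℝ := n * (1 / m - 1) / 2

lemma kap_pos (h : Pk n m T U vr ut) : 0 < kap n m := by
  have hn : (0:ℝ) < n := by exact_mod_cast h.hn
  have : 1 < 1 / m := by rw [lt_div_iff₀ h.hm0]; linarith [h.hm1]
  unfold kap
  have : 0 < 1 / m - 1 := by linarith
  positivity

/-- clamp -/
noncomputable def cl (t0 T t : ℝ) : ℝ := max t0 (min t T)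

lemma cl_mem {t0 T : ℝ} (h : t0 ≤ T) (t : ℝ) : cl t0 T t ∈ Icc t0 T :=
  ⟨le_max_left _ _, max_le h (min_le_right _ _)⟩

lemma cl_eq {t0 T t : ℝ} (h : t ∈ Icc t0 T) : cl t0 T t = t := by
  rw [cl, min_eq_left h.2, max_eq_right h.1]

lemma cl_cont {t0 T : ℝ} : Continuous (cl t0 T) := by unfold cl; fun_prop

noncomputable def Qf (n : ℕ) (m T : ℝ) (U : ℝ → ℝ → ℝ) (t0 s x : ℝ) : ℝ :=
  ∫ r in Ioi (0:ℝ), Real.sinh r ^ n * U r (cl t0 T s) * U r (cl t0 T x) ^ m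

/-- exponential domination -/
lemma dom (h : Pk n m T U vr ut) {t0 : ℝ} (ht0 : t0 ∈ Ioo 0 T) :
    ∃ K > 0, (∀ r ≥ 0, ∀ s ∈ Icc t0 T, ∀ x ∈ Icc t0 T,
      Real.sinh r ^ n * U r s * U r x ^ m ≤ K * Real.exp (-kap n m * r)) ∧
      (∀ r ≥ 0, ∀ s ∈ Icc t0 T, ∀ x ∈ Icc t0 T,
      Real.sinh r ^ n * U r s * PkW m T U r x ≤ K * Real.exp (-kap n m * r)) ∧
      (∀ r ≥ 0, ∀ s ∈ Icc t0 T, ∀ x ∈ Icc t0 T,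
      PkM n U r s * PkW m T U r x ≤ K * (r * Real.exp (-(min (kap n m) (n / 2)) * r))) := by
  obtain ⟨K, hK0, hK⟩ := h.expdecay ht0
  have hT := h.hT
  have hm0 := h.hm0
  have hKm : 0 < K ^ (1 / m) := Real.rpow_pos_of_pos hK0 _
  have hU : ∀ r ≥ 0, ∀ s ∈ Icc t0 T, Real.sinh r ^ n * U r s ≤
      K ^ (1 / m) * Real.exp ((n / 2 - kap n m) * r) := by
    intro r hr s hs
    have h1 := h.U_le hK0.le (hK r hr s hs)
    calc _ ≤ Real.exp (n * r) * (K ^ (1 / m) * Real.exp (-(n * r / 2 / m))) :=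
          mul_le_mul (sinhn_le' hr) h1 (h.nonneg _ _) (Real.exp_pos _).le
      _ = K ^ (1 / m) * (Real.exp (n * r) * Real.exp (-(n * r / 2 / m))) := by ring
      _ = _ := by
        rw [← Real.exp_add]; congr 2; unfold kap; field_simp; ring
  have hW : ∀ r ≥ 0, ∀ x ∈ Icc t0 T, PkW m T U r x ≤ T * (K * Real.exp (-(n * r / 2))) := by
    intro r hr x hx
    refine (h.W_le hx.2 (B := K * Real.exp (-(n * r / 2)))
      (fun s hs => hK r hr s ⟨hx.1.trans hs.1, hs.2⟩)).trans ?_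
    apply mul_le_mul_of_nonneg_right _ (by positivity)
    linarith [hx.1, ht0.1]
  have hmain : ∀ r ≥ 0, ∀ s ∈ Icc t0 T, 
      Real.sinh r ^ n * U r s * (K * Real.exp (-(n * r / 2))) ≤
      K ^ (1 / m) * K * Real.exp (-kap n m * r) := by
    intro r hr s hs
    calc _ ≤ (K ^ (1 / m) * Real.exp ((n / 2 - kap n m) * r)) * (K * Real.exp (-(n * r / 2))) := by
          apply mul_le_mul_of_nonneg_right (hU r hr s hs) (by positivity)
      _ = K ^ (1 / m) * K * (Real.exp ((n / 2 - kap n m) * r) * Real.exp (-(n * r / 2))) := by ring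
      _ = _ := by rw [← Real.exp_add]; congr 2; ring
  have hnn : ∀ r ≥ 0, ∀ s, 0 ≤ Real.sinh r ^ n * U r s := fun r hr s =>
    mul_nonneg (pow_nonneg (Real.sinh_nonneg_iff.2 hr) n) (h.nonneg r s)
  refine ⟨(1 + T) * (K ^ (1 / m) * K), by positivity, ?_, ?_, ?_⟩
  · intro r hr s hs x hx
    have h1 := mul_le_mul_of_nonneg_left (hK r hr x hx) (hnn r hr s)
    have h2 := h1.trans (hmain r hr s hs)
    refine h2.trans ?_
    apply mul_le_mul_of_nonneg_right _ (Real.exp_pos _).le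
    have : 0 < K ^ (1 / m) * K := by positivity
    nlinarith
  · intro r hr s hs x hx
    have h1 := mul_le_mul_of_nonneg_left (hW r hr x hx) (hnn r hr s)
    have h2 := mul_le_mul_of_nonneg_left (hmain r hr s hs) hT.le
    have h3 : 0 < K ^ (1 / m) * K * Real.exp (-kap n m * r) := by positivity
    calc _ ≤ _ := h1
      _ = T * (Real.sinh r ^ n * U r s * (K * Real.exp (-(n * r / 2)))) := by ring
      _ ≤ _ := h2
      _ ≤ _ := by nlinarith
  · intro r hr s hs x hx
    set k := min (kap n m) (n / 2) with hk
    have hM : PkM n U r s ≤ r * (K ^ (1 / m) * Real.exp ((n / 2 - k) * r)) := by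
      apply h.M_le hr
      intro σ hσ
      refine (hU σ hσ.1 s hs).trans ?_
      gcongr ?_ * Real.exp ?_
      have h1 : k ≤ kap n m := min_le_left _ _
      have h2 : k ≤ n / 2 := min_le_right _ _
      calc (n / 2 - kap n m) * σ ≤ (n / 2 - k) * σ :=
            mul_le_mul_of_nonneg_right (by linarith) hσ.1
        _ ≤ (n / 2 - k) * r := mul_le_mul_of_nonneg_left hσ.2 (by linarith)
    have h3 := mul_le_mul hM (hW r hr x hx) (h.W_nonneg r hx.2) (by positivity)
    refine h3.trans ?_
    have e : Real.exp ((n / 2 - k) * r) * Real.exp (-(n * r / 2)) = Real.exp (-k * r) := by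
      rw [← Real.exp_add]; congr 1; ring
    calc _ = T * (K ^ (1 / m) * K) * (r * (Real.exp ((n / 2 - k) * r) * Real.exp (-(n * r / 2)))) := by
          ring
      _ ≤ _ := by
        rw [e]
        have h5 : 0 ≤ (K ^ (1 / m) * K) * (r * Real.exp (-k * r)) := by positivity
        nlinarith

lemma cQint (h : Pk n m T U vr ut) (s x : ℝ) :
    Continuous fun r => Real.sinh r ^ n * U r s * U r x ^ m :=
  ((Real.continuous_sinh.pow n).mul (h.cU2 s)).mul (h.cV2 x)

lemma integrable_exp (h : Pk n m T U vr ut) (K : ℝ) :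
    IntegrableOn (fun r => K * Real.exp (-kap n m * r)) (Ioi 0) :=
  (integrableOn_exp_mul_Ioi (by linarith [h.kap_pos]) 0).const_mul K

lemma nnU (h : Pk n m T U vr ut) {r : ℝ} (hr : 0 ≤ r) (s : ℝ) : 0 ≤ Real.sinh r ^ n * U r s :=
  mul_nonneg (pow_nonneg (Real.sinh_nonneg_iff.2 hr) n) (h.nonneg r s)

lemma intQ (h : Pk n m T U vr ut) {t0 : ℝ} (ht0 : t0 ∈ Ioo 0 T) {s x : ℝ} (hs : s ∈ Icc t0 T)
    (hx : x ∈ Icc t0 T) :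
    IntegrableOn (fun r => Real.sinh r ^ n * U r s * U r x ^ m) (Ioi 0) := by
  obtain ⟨K, hK0, hK, -, -⟩ := h.dom ht0
  refine (h.integrable_exp K).mono' (h.cQint s x).aestronglyMeasurable ?_
  filter_upwards [ae_restrict_mem measurableSet_Ioi] with r hr
  rw [Real.norm_of_nonneg (mul_nonneg (h.nnU (le_of_lt hr) s) (h.nonnegV r x))]
  exact hK r (le_of_lt hr) s hs x hx

lemma intW (h : Pk n m T U vr ut) {t0 : ℝ} (ht0 : t0 ∈ Ioo 0 T) {s x : ℝ} (hs : s ∈ Icc t0 T)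
    (hx : x ∈ Icc t0 T) :
    IntegrableOn (fun r => Real.sinh r ^ n * U r s * PkW m T U r x) (Ioi 0) := by
  obtain ⟨K, hK0, -, hK, -⟩ := h.dom ht0
  refine (h.integrable_exp K).mono'
    (((Real.continuous_sinh.pow n).mul (h.cU2 s)).mul (h.cW1 x)).aestronglyMeasurable ?_
  filter_upwards [ae_restrict_mem measurableSet_Ioi] with r hr
  rw [Real.norm_of_nonneg (mul_nonneg (h.nnU (le_of_lt hr) s) (h.W_nonneg r hx.2))]
  exact hK r (le_of_lt hr) s hs x hx

lemma contQ (h : Pk n m T U vr ut) {t0 : ℝ} (ht0 : t0 ∈ Ioo 0 T) :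
    Continuous fun p : ℝ × ℝ => Qf n m T U t0 p.1 p.2 := by
  obtain ⟨K, hK0, hK, -, -⟩ := h.dom ht0
  unfold Qf
  apply MeasureTheory.continuous_of_dominated (bound := fun r => K * Real.exp (-kap n m * r))
  · intro p
    exact (h.cQint _ _).aestronglyMeasurable
  · intro p
    filter_upwards [ae_restrict_mem measurableSet_Ioi] with r hr
    rw [Real.norm_of_nonneg (mul_nonneg (h.nnU (le_of_lt hr) _) (h.nonnegV r _))]
    exact hK r (le_of_lt hr) _ (cl_mem ht0.2.le _) _ (cl_mem ht0.2.le _)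
  · exact h.integrable_exp K
  · refine Eventually.of_forall fun r => ?_
    have c1 : Continuous fun p : ℝ × ℝ => U r (cl t0 T p.1) :=
      h.cont.comp (g := fun p : ℝ × ℝ => U p.1 p.2) (f := fun p : ℝ × ℝ => (r, cl t0 T p.1))
        (continuous_const.prodMk (cl_cont.comp continuous_fst))
    have c2 : Continuous fun p : ℝ × ℝ => U r (cl t0 T p.2) ^ m :=
      h.contV.comp (g := fun p : ℝ × ℝ => U p.1 p.2 ^ m) (f := fun p : ℝ × ℝ => (r, cl t0 T p.2))
        (continuous_const.prodMk (cl_cont.comp continuous_snd))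
    exact (continuous_const.mul c1).mul c2

lemma b_eq (h : Pk n m T U vr ut) {t0 : ℝ} (ht0 : t0 ∈ Ioo 0 T) {s x : ℝ} (hs : s ∈ Icc t0 T)
    (hx : x ∈ Icc t0 T) :
    ∫ r in Ioi (0:ℝ), Real.sinh r ^ n * U r s * PkW m T U r x = ∫ τ in x..T, Qf n m T U t0 s τ := by
  obtain ⟨K, hK0, hK, -, -⟩ := h.dom ht0
  rw [intervalIntegral.integral_of_le hx.2]
  have e1 : ∫ τ in Ioc x T, Qf n m T U t0 s τ
      = ∫ τ in Ioc x T, ∫ r in Ioi (0:ℝ), Real.sinh r ^ n * U r s * U r τ ^ m := by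
    apply setIntegral_congr_fun measurableSet_Ioc
    intro τ hτ
    simp only [Qf, cl_eq hs, cl_eq (show τ ∈ Icc t0 T from ⟨hx.1.trans hτ.1.le, hτ.2⟩)]
  rw [e1, integral_integral_swap]
  · apply setIntegral_congr_fun measurableSet_Ioi
    intro r hr
    simp only [PkW]
    rw [intervalIntegral.integral_of_le hx.2, integral_const_mul]
  · have hb : Integrable (fun p : ℝ × ℝ => K * Real.exp (-kap n m * p.2))
        ((volume.restrict (Ioc x T)).prod (volume.restrict (Ioi 0))) :=
      Integrable.comp_snd (f := fun r => K * Real.exp (-kap n m * r)) (h.integrable_exp K) _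
    refine hb.mono' ?_ ?_
    · apply Continuous.aestronglyMeasurable
      have c1 : Continuous fun p : ℝ × ℝ => U p.2 s :=
        (h.cU2 s).comp continuous_snd
      have c2 : Continuous fun p : ℝ × ℝ => U p.2 p.1 ^ m :=
        h.contV.comp (g := fun p : ℝ × ℝ => U p.1 p.2 ^ m) (f := fun p : ℝ × ℝ => (p.2, p.1))
          (by fun_prop)
      have c3 : Continuous fun p : ℝ × ℝ => Real.sinh p.2 ^ n := by fun_prop
      exact (c3.mul c1).mul c2
    · rw [Measure.prod_restrict]
      filter_upwards [ae_restrict_mem (measurableSet_Ioc.prod measurableSet_Ioi)] with p hp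
      simp only [Function.uncurry]
      rw [Real.norm_of_nonneg (mul_nonneg (h.nnU (le_of_lt hp.2) _) (h.nonnegV _ _))]
      exact hK p.2 (le_of_lt hp.2) s hs p.1 ⟨hx.1.trans hp.1.1.le, hp.1.2⟩

lemma b_symm (h : Pk n m T U vr ut) {t0 : ℝ} (ht0 : t0 ∈ Ioo 0 T) {s x : ℝ} (hs : s ∈ Ico t0 T)
    (hx : x ∈ Ico t0 T) :
    ∫ r in Ioi (0:ℝ), Real.sinh r ^ n * U r s * PkW m T U r x
      = ∫ r in Ioi (0:ℝ), Real.sinh r ^ n * U r x * PkW m T U r s := by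
  obtain ⟨K, hK0, -, -, hK⟩ := h.dom ht0
  have hs' : s ∈ Icc t0 T := ⟨hs.1, hs.2.le⟩
  have hx' : x ∈ Icc t0 T := ⟨hx.1, hx.2.le⟩
  have hsI : s ∈ Ioo 0 T := ⟨ht0.1.trans_le hs.1, hs.2⟩
  have hxI : x ∈ Ioo 0 T := ⟨ht0.1.trans_le hx.1, hx.2⟩
  have i1 := h.intW ht0 hs' hx'
  have i2 := h.intW ht0 hx' hs'
  rw [← sub_eq_zero, ← integral_sub i1 i2]
  set f := fun r => Real.sinh r ^ n * U r s * PkW m T U r x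
    - Real.sinh r ^ n * U r x * PkW m T U r s with hf
  have cf : Continuous f :=
    (((Real.continuous_sinh.pow n).mul (h.cU2 s)).mul (h.cW1 x)).sub
    (((Real.continuous_sinh.pow n).mul (h.cU2 x)).mul (h.cW1 s))
  have l1 := intervalIntegral_tendsto_integral_Ioi (μ := volume) (f := f) 0 (i1.sub i2) tendsto_id
  have e : ∀ R ≥ (0:ℝ), ∫ r in (0:ℝ)..R, f r
      = PkM n U R s * PkW m T U R x - PkM n U R x * PkW m T U R s := by
    intro R hR
    have := intervalIntegral.integral_eq_sub_of_hasDerivAt_of_le (a := 0) (b := R) (f' := f)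
      (f := fun r => PkM n U r s * PkW m T U r x - PkM n U r x * PkW m T U r s) hR
      (((h.cM1 s).mul (h.cW1 x)).sub ((h.cM1 x).mul (h.cW1 s))).continuousOn
      (fun r hr => by
        have d := ((h.derivM r s).mul (h.derivW hxI hr.1)).sub
          ((h.derivM r x).mul (h.derivW hsI hr.1))
        refine HasDerivAt.congr_deriv d ?_
        simp only [hf]
        ring) (cf.intervalIntegrable _ _)
    rw [this]
    simp [PkM]
  have hk : 0 < min (kap n m) (n / 2) := by
    have hn : (0:ℝ) < n := by exact_mod_cast h.hn
    exact lt_min h.kap_pos (by positivity)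
  have lz : Tendsto (fun R : ℝ => K * (R * Real.exp (-(min (kap n m) (n / 2)) * R))) atTop (𝓝 0) := by
    have := (tendsto_rpow_mul_exp_neg_mul_atTop_nhds_zero 1 _ hk).const_mul K
    simpa using this
  have l3 : ∀ a ∈ Icc t0 T, ∀ c ∈ Icc t0 T,
      Tendsto (fun R => PkM n U R a * PkW m T U R c) atTop (𝓝 0) := by
    intro a ha c hc
    refine tendsto_of_tendsto_of_tendsto_of_le_of_le' tendsto_const_nhds lz ?_ ?_
    · filter_upwards [eventually_ge_atTop 0] with R hR
      exact mul_nonneg (h.M_nonneg hR a) (h.W_nonneg R hc.2)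
    · filter_upwards [eventually_ge_atTop 0] with R hR
      exact hK R hR a ha c hc
  have l4 := (l3 s hs' x hx').sub (l3 x hx' s hs')
  rw [sub_zero] at l4
  refine tendsto_nhds_unique (l1.congr' ?_) l4
  filter_upwards [eventually_ge_atTop 0] with R hR
  exact e R hR

lemma MW_le_X (h : Pk n m T U vr ut) {t0 : ℝ} (ht0 : t0 ∈ Ioo 0 T) {t : ℝ} (ht : t ∈ Ico t0 T)
    {r : ℝ} (hr : 0 ≤ r) :
    PkM n U r t * PkW m T U r t ≤ ∫ r in Ioi (0:ℝ), Real.sinh r ^ n * U r t * PkW m T U r t := by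
  have htI : t ∈ Ioo 0 T := ⟨ht0.1.trans_le ht.1, ht.2⟩
  have ht' : t ∈ Icc t0 T := ⟨ht.1, ht.2.le⟩
  have i1 := h.intW ht0 ht' ht'
  have cf : Continuous fun s => Real.sinh s ^ n * U s t :=
    (Real.continuous_sinh.pow n).mul (h.cU2 t)
  calc PkM n U r t * PkW m T U r t
      = ∫ s in (0:ℝ)..r, Real.sinh s ^ n * U s t * PkW m T U r t := by
        rw [intervalIntegral.integral_mul_const]; rfl
    _ ≤ ∫ s in (0:ℝ)..r, Real.sinh s ^ n * U s t * PkW m T U s t := by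
        apply intervalIntegral.integral_mono_on hr
        · exact (cf.mul continuous_const).intervalIntegrable _ _
        · exact (cf.mul (h.cW1 t)).intervalIntegrable _ _
        · intro s hs
          exact mul_le_mul_of_nonneg_left (h.W_anti_r htI hs.1 hr hs.2) (h.nnU hs.1 t)
    _ = ∫ s in Ioc 0 r, Real.sinh s ^ n * U s t * PkW m T U s t := by
        rw [intervalIntegral.integral_of_le hr]
    _ ≤ _ := by
        apply setIntegral_mono_set i1 _ (Eventually.of_forall Ioc_subset_Ioi_self)
        filter_upwards [ae_restrict_mem measurableSet_Ioi] with s hs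
        exact mul_nonneg (h.nnU (le_of_lt hs) t) (h.W_nonneg s ht.2.le)

end Pk

namespace Pk
variable {n : ℕ} {m T : ℝ} {U vr ut : ℝ → ℝ → ℝ}

lemma deriv_diag {f : ℝ → ℝ → ℝ} (hf : Continuous fun p : ℝ × ℝ => f p.1 p.2) (s : ℝ) :
    HasDerivAt (fun x => ∫ τ in s..x, f x τ) (f s s) s := by
  rw [hasDerivAt_iff_isLittleO]
  simp only [intervalIntegral.integral_same, sub_zero]
  rw [Asymptotics.isLittleO_iff]
  intro c hc
  have := Metric.continuousAt_iff.1 (hf.continuousAt (x := (s, s))) c hc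
  obtain ⟨δ, hδ, hd⟩ := this
  filter_upwards [Metric.ball_mem_nhds s hδ] with x hx
  have ci : Continuous fun τ => f x τ :=
    hf.comp (g := fun p : ℝ × ℝ => f p.1 p.2) (f := fun τ => (x, τ)) (by fun_prop)
  have e : (∫ τ in s..x, f x τ) - (x - s) • f s s = ∫ τ in s..x, (f x τ - f s s) := by
    rw [intervalIntegral.integral_sub (ci.intervalIntegrable _ _) intervalIntegrable_const,
      intervalIntegral.integral_const]
  rw [e]
  have hb : ∀ τ ∈ uIoc s x, ‖f x τ - f s s‖ ≤ c := by
    intro τ hτ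
    have h1 : dist (x, τ) (s, s) < δ := by
      rw [Prod.dist_eq]
      refine max_lt hx ?_
      refine lt_of_le_of_lt ?_ hx
      rw [Real.dist_eq, Real.dist_eq]
      exact abs_sub_left_of_mem_uIcc (uIoc_subset_uIcc hτ)
    exact (hd h1).le
  exact intervalIntegral.norm_integral_le_of_norm_le_const hb

/-- The abstract ODE argument. -/
lemma ode (hm0 : 0 < m) (hm1 : m < 1) {t0 : ℝ} (ht0 : t0 < T) {X y : ℝ → ℝ} (hy : Continuous y)
    (hy0 : ∀ t, 0 ≤ y t) (hyp : ∀ t ∈ Ico t0 T, 0 < y t) (hX : Continuous X)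
    (hXd : ∀ t ∈ Ioo t0 T, HasDerivAt X (-2 * y t) t) (hXT : X T = 0)
    (hH : ∀ t ∈ Ico t0 T, X t ≤ y t ^ (1 / (m + 1)) * ∫ τ in t..T, y τ ^ (m / (m + 1))) :
    ∃ C > 0, ∀ t ∈ Ico t0 T, X t ≤ C * (T - t) ^ (2 / (1 - m)) := by
  set θ := m / (m + 1) with hθ
  have hθ0 : 0 < θ := by positivity
  have hθ1 : θ < 1 := by rw [hθ, div_lt_one (by linarith)]; linarith
  have h1θ : 1 / (m + 1) = 1 - θ := by rw [hθ]; field_simp; ring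
  rw [h1θ] at hH
  have cyθ : Continuous fun t => y t ^ θ := hy.rpow_const (fun _ => Or.inr hθ0.le)
  set A : ℝ → ℝ := fun t => ∫ τ in t..T, y τ ^ θ with hA
  have dA : ∀ t, HasDerivAt A (-(y t ^ θ)) t := fun t =>
    intervalIntegral.integral_hasDerivAt_left (cyθ.intervalIntegrable _ _)
    (cyθ.stronglyMeasurableAtFilter _ _) cyθ.continuousAt
  have cA : Continuous A := continuous_iff_continuousAt.2 fun t => (dA t).continuousAt
  have Apos : ∀ t ∈ Ico t0 T, 0 < A t := by
    intro t ht
    apply intervalIntegral.intervalIntegral_pos_of_pos_on (cyθ.intervalIntegrable _ _) _ ht.2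
    intro x hx
    exact Real.rpow_pos_of_pos (hyp x ⟨ht.1.trans hx.1.le, hx.2⟩) _
  have eX : ∀ t ∈ Ico t0 T, X t = 2 * ∫ τ in t..T, y τ := by
    intro t ht
    have := intervalIntegral.integral_eq_sub_of_hasDerivAt_of_le (a := t) (b := T)
      (f' := fun t => -2 * y t) (f := X) ht.2.le hX.continuousOn
      (fun s hs => hXd s ⟨ht.1.trans_lt hs.1, hs.2⟩)
      ((continuous_const.mul hy).intervalIntegrable _ _)
    rw [intervalIntegral.integral_const_mul, hXT] at this
    linarith
  have Xpos : ∀ t ∈ Ico t0 T, 0 < X t := by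
    intro t ht
    rw [eX t ht]
    have : 0 < ∫ τ in t..T, y τ := by
      apply intervalIntegral.intervalIntegral_pos_of_pos_on (hy.intervalIntegrable _ _) _ ht.2
      intro x hx
      exact hyp x ⟨ht.1.trans hx.1.le, hx.2⟩
    linarith
  have anti : AntitoneOn (fun t => X t / A t ^ 2) (Ico t0 T) := by
    apply antitoneOn_of_hasDerivWithinAt_nonpos (convex_Ico t0 T)
      (f' := fun t => 2 * y t ^ θ / A t ^ 3 * (X t - y t ^ (1 - θ) * A t))
    · exact hX.continuousOn.div (cA.pow 2).continuousOn (fun t ht => (pow_pos (Apos t ht) 2).ne')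
    · intro t ht
      rw [interior_Ico] at ht
      have ht' : t ∈ Ico t0 T := ⟨ht.1.le, ht.2⟩
      have hAp := Apos t ht'
      have d := (hXd t ht).div ((dA t).pow 2) (pow_pos hAp 2).ne'
      refine (HasDerivAt.congr_deriv d ?_).hasDerivWithinAt
      have e : y t = y t ^ θ * y t ^ (1 - θ) := by
        rw [← Real.rpow_add (hyp t ht')]; simp
      have hyt : -2 * y t = -2 * (y t ^ θ * y t ^ (1 - θ)) := by rw [← e]
      rw [hyt]
      simp only [Pi.pow_apply, Nat.cast_ofNat, Nat.add_one_sub_one, pow_one]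
      field_simp
      ring
    · intro t ht
      rw [interior_Ico] at ht
      have ht' : t ∈ Ico t0 T := ⟨ht.1.le, ht.2⟩
      have hAp := Apos t ht'
      have hyp' := Real.rpow_pos_of_pos (hyp t ht') θ
      apply mul_nonpos_of_nonneg_of_nonpos (by positivity)
      linarith [hH t ht']
  have ht0' : t0 ∈ Ico t0 T := ⟨le_rfl, ht0⟩
  set c := X t0 / A t0 ^ 2 with hc
  have cpos : 0 < c := div_pos (Xpos _ ht0') (pow_pos (Apos _ ht0') 2)
  have hXA : ∀ t ∈ Ico t0 T, X t ≤ c * A t ^ 2 := by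
    intro t ht
    have := anti ht0' ht ht.1
    simp only at this
    rwa [div_le_iff₀ (pow_pos (Apos t ht) 2)] at this
  refine ⟨(4 * c) ^ ((1 + m) / (1 - m)), by positivity, fun t ht => ?_⟩
  have hTt : 0 < T - t := by linarith [ht.2]
  set η := X t / (T - t) with hη
  have ηpos : 0 < η := div_pos (Xpos t ht) hTt
  have Xη : X t = η * (T - t) := by rw [hη]; field_simp
  have hAle : A t ≤ 2 * (T - t) * η ^ θ := by
    have h1 : A t ≤ ∫ τ in t..T, (y τ / η + 1) * η ^ θ := by
      apply intervalIntegral.integral_mono_on ht.2.le (cyθ.intervalIntegrable _ _)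
        ((((hy.div_const η).add continuous_const).mul continuous_const).intervalIntegrable _ _)
      intro τ _
      have hz : 0 ≤ y τ / η := div_nonneg (hy0 τ) ηpos.le
      have : y τ ^ θ = (y τ / η) ^ θ * η ^ θ := by
        rw [← Real.mul_rpow hz ηpos.le]; congr 1; field_simp
      rw [this]
      apply mul_le_mul_of_nonneg_right _ (Real.rpow_nonneg ηpos.le _)
      calc (y τ / η) ^ θ ≤ (y τ / η + 1) ^ θ := by
            apply Real.rpow_le_rpow hz (by linarith) hθ0.le
        _ ≤ (y τ / η + 1) ^ (1:ℝ) := Real.rpow_le_rpow_of_exponent_le (by linarith) hθ1.le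
        _ = _ := Real.rpow_one _
    refine h1.trans ?_
    rw [intervalIntegral.integral_mul_const, intervalIntegral.integral_add
      ((hy.div_const η).intervalIntegrable _ _) intervalIntegrable_const,
      intervalIntegral.integral_div, intervalIntegral.integral_const]
    apply mul_le_mul_of_nonneg_right _ (Real.rpow_nonneg ηpos.le _)
    have h2 : (∫ τ in t..T, y τ) = η * (T - t) / 2 := by linarith [eX t ht]
    rw [h2]
    have : η * (T - t) / 2 / η = (T - t) / 2 := by field_simp
    rw [this]
    simp only [smul_eq_mul]
    linarith
  have h3 : η * (T - t) ≤ c * (2 * (T - t) * η ^ θ) ^ 2 := by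
    rw [← Xη]
    refine (hXA t ht).trans ?_
    have := Apos t ht
    gcongr
  have h4 : η ^ (1 - 2 * θ) ≤ 4 * c * (T - t) := by
    have e1 : η ^ (1 - 2 * θ) = η / (η ^ θ) ^ 2 := by
      rw [Real.rpow_sub ηpos, Real.rpow_one, mul_comm 2 θ, Real.rpow_mul ηpos.le]; norm_cast
    have hp := Real.rpow_pos_of_pos ηpos θ
    rw [e1, div_le_iff₀ (by positivity)]
    have : (T - t) * η ≤ (T - t) * (4 * c * (T - t) * (η ^ θ) ^ 2) := by nlinarith
    exact le_of_mul_le_mul_left this hTt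
  have h5 : η ≤ (4 * c * (T - t)) ^ ((1 + m) / (1 - m)) := by
    have := Real.rpow_le_rpow (Real.rpow_nonneg ηpos.le _) h4 (z := (1 + m) / (1 - m))
      (div_nonneg (by linarith) (by linarith))
    rw [← Real.rpow_mul ηpos.le] at this
    have e : (1 - 2 * θ) * ((1 + m) / (1 - m)) = 1 := by
      have : 1 - m ≠ 0 := by linarith
      rw [hθ]; field_simp; ring
    rwa [e, Real.rpow_one] at this
  rw [Real.mul_rpow (by positivity) hTt.le] at h5
  rw [Xη]
  have e2 : (T - t) ^ (2 / (1 - m)) = (T - t) ^ ((1 + m) / (1 - m)) * (T - t) := by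
    rw [← Real.rpow_add_one hTt.ne']
    congr 1
    have : 1 - m ≠ 0 := by linarith
    field_simp; ring
  rw [e2, ← mul_assoc]
  exact mul_le_mul_of_nonneg_right h5 hTt.le

lemma Qf_eq {t0 s x : ℝ} (hs : s ∈ Icc t0 T) (hx : x ∈ Icc t0 T) :
    Qf n m T U t0 s x = ∫ r in Ioi (0:ℝ), Real.sinh r ^ n * U r s * U r x ^ m := by
  simp only [Qf, cl_eq hs, cl_eq hx]

lemma Qf_nonneg (h : Pk n m T U vr ut) (t0 s x : ℝ) : 0 ≤ Qf n m T U t0 s x := by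
  apply setIntegral_nonneg measurableSet_Ioi
  intro r hr
  exact mul_nonneg (h.nnU (le_of_lt hr) _) (h.nonnegV _ _)

lemma y_pos (h : Pk n m T U vr ut) {t0 : ℝ} (ht0 : t0 ∈ Ioo 0 T) {t : ℝ} (ht : t ∈ Ico t0 T) :
    0 < Qf n m T U t0 t t := by
  have ht' : t ∈ Icc t0 T := ⟨ht.1, ht.2.le⟩
  have htI : t ∈ Ioo 0 T := ⟨ht0.1.trans_le ht.1, ht.2⟩
  have hp : ∀ r > 0, 0 < Real.sinh r ^ n * U r t * U r t ^ m := fun r hr =>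
    mul_pos (mul_pos (sinhn_pos hr) (h.pos r t htI)) (Real.rpow_pos_of_pos (h.pos r t htI) m)
  rw [Qf_eq ht' ht', setIntegral_pos_iff_support_of_nonneg_ae _ (h.intQ ht0 ht' ht')]
  · refine lt_of_lt_of_le ?_ (measure_mono (s := Ioi (0:ℝ)) ?_)
    · simp
    · intro r hr
      exact ⟨(hp r hr).ne', hr⟩
  · filter_upwards [ae_restrict_mem measurableSet_Ioi] with r hr
    exact (hp r hr).le

lemma holder (h : Pk n m T U vr ut) {t0 : ℝ} (ht0 : t0 ∈ Ioo 0 T) {t : ℝ} (ht : t ∈ Ico t0 T)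
    {τ : ℝ} (hτ : τ ∈ Icc t T) :
    Qf n m T U t0 t τ ≤ Qf n m T U t0 t t ^ (1 / (m + 1)) * Qf n m T U t0 τ τ ^ (m / (m + 1)) := by
  have hm0 := h.hm0
  rcases eq_or_lt_of_le hτ.2 with hτT | hτT
  · subst hτT
    have hTT : τ ∈ Icc t0 τ := ⟨ht0.2.le, le_rfl⟩
    have : Qf n m τ U t0 t τ = 0 := by
      rw [Qf_eq ⟨ht.1, ht.2.le⟩ hTT]
      simp [h.ext, Real.zero_rpow hm0.ne']
    rw [this]
    exact mul_nonneg (Real.rpow_nonneg (h.Qf_nonneg _ _ _) _) (Real.rpow_nonneg (h.Qf_nonneg _ _ _) _)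
  have ht' : t ∈ Icc t0 T := ⟨ht.1, ht.2.le⟩
  have hτ0 : τ ∈ Ico t0 T := ⟨ht.1.trans hτ.1, hτT⟩
  have hτ' : τ ∈ Icc t0 T := ⟨hτ0.1, hτ.2⟩
  have ha := h.y_pos ht0 ht
  have hb := h.y_pos ht0 hτ0
  set a := Qf n m T U t0 t t with haa
  set b := Qf n m T U t0 τ τ with hbb
  set p := 1 / (m + 1) with hp
  set q := m / (m + 1) with hq
  have hp0 : 0 < p := by positivity
  have hq0 : 0 < q := by positivity
  have hpq : p + q = 1 := by rw [hp, hq]; field_simp; ring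
  have hap := Real.rpow_pos_of_pos ha p
  have hbq := Real.rpow_pos_of_pos hb q
  have e1 : ∀ x ≥ (0:ℝ), x = (x * x ^ m) ^ p := by
    intro x hx
    rcases eq_or_lt_of_le hx with rfl | hx0
    · simp [Real.zero_rpow hp0.ne']
    rw [← Real.rpow_one_add' hx (by linarith), ← Real.rpow_mul hx,
      show (1 + m) * p = 1 by rw [hp]; field_simp; ring, Real.rpow_one]
  have e2 : ∀ x ≥ (0:ℝ), x ^ m = (x * x ^ m) ^ q := by
    intro x hx
    rw [← Real.rpow_one_add' hx (by linarith), ← Real.rpow_mul hx,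
      show (1 + m) * q = m by rw [hq]; field_simp; ring]
  have pw : ∀ r ∈ Ioi (0:ℝ), Real.sinh r ^ n * U r t * U r τ ^ m ≤
      a ^ p * b ^ q * (p / a * (Real.sinh r ^ n * U r t * U r t ^ m)
        + q / b * (Real.sinh r ^ n * U r τ * U r τ ^ m)) := by
    intro r hr
    have hs := (sinhn_pos (n := n) hr).le
    have nt := h.nonneg r t
    have nτ := h.nonneg r τ
    have ni := h.nonnegV r t
    have nj := h.nonnegV r τ
    have am := Real.geom_mean_le_arith_mean2_weighted hp0.le hq0.le
      (p₁ := U r t * U r t ^ m / a) (p₂ := U r τ * U r τ ^ m / b) (by positivity) (by positivity) hpq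
    rw [Real.div_rpow (by positivity) ha.le, Real.div_rpow (by positivity) hb.le,
      ← e1 _ nt, ← e2 _ nτ] at am
    calc Real.sinh r ^ n * U r t * U r τ ^ m
        = a ^ p * b ^ q * Real.sinh r ^ n * (U r t / a ^ p * (U r τ ^ m / b ^ q)) := by
          field_simp
      _ ≤ a ^ p * b ^ q * Real.sinh r ^ n * (p * (U r t * U r t ^ m / a) + q * (U r τ * U r τ ^ m / b)) := by
          gcongr
      _ = _ := by ring
  have i1 := (h.intQ ht0 ht' ht').const_mul (p / a)
  have i2 := (h.intQ ht0 hτ' hτ').const_mul (q / b)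
  rw [Qf_eq ht' hτ']
  refine (setIntegral_mono_on (h.intQ ht0 ht' hτ') ((i1.add i2).const_mul (a ^ p * b ^ q))
    measurableSet_Ioi pw).trans ?_
  rw [integral_const_mul]
  simp only [Pi.add_apply]
  rw [integral_add i1 i2, integral_const_mul, integral_const_mul, ← Qf_eq ht' ht',
    ← Qf_eq hτ' hτ', ← haa, ← hbb]
  rw [div_mul_cancel₀ _ ha.ne', div_mul_cancel₀ _ hb.ne', hpq, mul_one]

lemma energy (h : Pk n m T U vr ut) {t0 : ℝ} (ht0 : t0 ∈ Ioo 0 T) :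
    ∃ C > 0, ∀ t ∈ Ico t0 T, ∀ r ≥ 0,
      PkM n U r t * PkW m T U r t ≤ C * (T - t) ^ (2 / (1 - m)) := by
  set Q := Qf n m T U t0 with hQ
  have cQ : Continuous fun p : ℝ × ℝ => Q p.1 p.2 := h.contQ ht0
  have cQ2 : ∀ s, Continuous fun τ => Q s τ := fun s =>
    cQ.comp (g := fun p : ℝ × ℝ => Q p.1 p.2) (f := fun τ => (s, τ)) (by fun_prop)
  have cy : Continuous fun t => Q t t :=
    cQ.comp (g := fun p : ℝ × ℝ => Q p.1 p.2) (f := fun τ => (τ, τ)) (by fun_prop)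
  set X : ℝ → ℝ := fun t => ∫ τ in t..T, Q t τ with hX
  have cX : Continuous X := by
    have c1 : Continuous (Function.uncurry fun t τ => Q t τ) := cQ
    have := intervalIntegral.continuous_parametric_intervalIntegral_of_continuous (μ := volume)
      (a₀ := T) c1 (s := fun t => t) continuous_id
    have e : X = fun t => -∫ τ in T..t, Q t τ := by
      funext t; simp only [hX]; rw [intervalIntegral.integral_symm]
    rw [e]; exact this.neg
  have key : ∀ s ∈ Ico t0 T, ∀ x ∈ Ico t0 T,
      X x = X s - (∫ τ in s..x, Q s τ) - ∫ τ in s..x, Q x τ := by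
    intro s hs x hx
    have hs' : s ∈ Icc t0 T := ⟨hs.1, hs.2.le⟩
    have hx' : x ∈ Icc t0 T := ⟨hx.1, hx.2.le⟩
    have h1 := h.b_symm ht0 hs hx
    rw [h.b_eq ht0 hs' hx', h.b_eq ht0 hx' hs'] at h1
    have a1 := intervalIntegral.integral_add_adjacent_intervals (μ := volume)
      ((cQ2 s).intervalIntegrable s x) ((cQ2 s).intervalIntegrable x T)
    have a2 := intervalIntegral.integral_add_adjacent_intervals (μ := volume)
      ((cQ2 x).intervalIntegrable s x) ((cQ2 x).intervalIntegrable x T)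
    simp only [hX]
    simp only [← hQ] at h1
    linarith
  have dX : ∀ t ∈ Ioo t0 T, HasDerivAt X (-2 * Q t t) t := by
    intro t ht
    have d1 := deriv_diag (f := fun _ τ => Q t τ)
      ((cQ2 t).comp continuous_snd) t
    have d2 := deriv_diag (f := Q) cQ t
    have d := (((hasDerivAt_const t (X t)).sub d1).sub d2)
    have d' : HasDerivAt (fun x => X t - (∫ τ in t..x, Q t τ) - ∫ τ in t..x, Q x τ) (-2 * Q t t) t :=
      HasDerivAt.congr_deriv d (by ring)
    refine d'.congr_of_eventuallyEq ?_
    filter_upwards [Ioo_mem_nhds ht.1 ht.2] with x hx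
    exact key t ⟨ht.1.le, ht.2⟩ x ⟨hx.1.le, hx.2⟩
  have cyθ : Continuous fun t => Q t t ^ (m / (m + 1)) := cy.rpow_const
    (fun _ => Or.inr (by have := h.hm0; positivity))
  obtain ⟨C, hC, hb⟩ := ode h.hm0 h.hm1 ht0.2 cy (fun t => h.Qf_nonneg _ _ _)
    (fun t ht => h.y_pos ht0 ht) cX dX (by simp [hX]) (by
      intro t ht
      simp only [hX]
      rw [← intervalIntegral.integral_const_mul]
      apply intervalIntegral.integral_mono_on ht.2.le ((cQ2 t).intervalIntegrable _ _)
        ((continuous_const.mul cyθ).intervalIntegrable _ _)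
      intro τ hτ
      exact h.holder ht0 ht hτ)
  refine ⟨C, hC, fun t ht r hr => ?_⟩
  refine ((h.MW_le_X ht0 ht hr).trans_eq ?_).trans (hb t ht)
  exact h.b_eq ht0 ⟨ht.1, ht.2.le⟩ ⟨ht.1, ht.2.le⟩

end Pk

namespace Pk
variable {n : ℕ} {m T : ℝ} {U vr ut : ℝ → ℝ → ℝ}

lemma W_tendsto (h : Pk n m T U vr ut) {t : ℝ} (ht : t ∈ Ioo 0 T) :
    Tendsto (fun r => PkW m T U r t) atTop (𝓝 0) := by
  obtain ⟨K, hK0, hK⟩ := h.expdecay ht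
  have hn : (0:ℝ) < n := by exact_mod_cast h.hn
  have l : Tendsto (fun r : ℝ => (T - t) * (K * Real.exp (-(n * r / 2)))) atTop (𝓝 0) := by
    have : Tendsto (fun r : ℝ => Real.exp (-(n * r / 2))) atTop (𝓝 0) := by
      apply Real.tendsto_exp_neg_atTop_nhds_zero.comp
      exact (tendsto_id.const_mul_atTop hn).atTop_div_const (by norm_num)
    simpa using (this.const_mul K).const_mul (T - t)
  refine tendsto_of_tendsto_of_tendsto_of_le_of_le' tendsto_const_nhds l ?_ ?_
  · exact Eventually.of_forall fun r => h.W_nonneg r ht.2.le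
  · filter_upwards [eventually_ge_atTop 0] with r hr
    exact h.W_le ht.2.le (fun s hs => hK r hr s hs)

lemma nonpos_of_mono {g : ℝ → ℝ} {a : ℝ} (hg : MonotoneOn g (Ici a)) (hl : Tendsto g atTop (𝓝 0))
    {r : ℝ} (hr : a ≤ r) : g r ≤ 0 := by
  refine ge_of_tendsto hl ?_
  filter_upwards [eventually_ge_atTop r] with s hs
  exact hg hr (hr.trans hs) hs

lemma sqrtT {z : ℝ} (hz : 0 < z) : z ^ (2 / (1 - m)) = (z ^ (1 / (1 - m))) ^ 2 := by
  rw [← Real.rpow_natCast, ← Real.rpow_mul hz.le]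
  congr 1
  push_cast
  ring

lemma outer (h : Pk n m T U vr ut) {t0 : ℝ} (ht0 : t0 ∈ Ioo 0 T) :
    ∃ C > 0, ∀ t ∈ Ico t0 T, ∀ r ≥ 1,
      PkW m T U r t ≤ C * (T - t) ^ (1 / (1 - m)) * Real.exp (-(n * r / 2)) := by
  obtain ⟨E, hE, hb⟩ := h.energy ht0
  have hn : (0:ℝ) < n := by exact_mod_cast h.hn
  refine ⟨Real.sqrt (2 * E * 4 ^ n / n), by positivity, fun t ht r hr => ?_⟩
  have htI : t ∈ Ioo 0 T := ⟨ht0.1.trans_le ht.1, ht.2⟩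
  have hTt : 0 < T - t := by linarith [ht.2]
  set X := E * (T - t) ^ (2 / (1 - m)) with hX
  have hX0 : 0 < X := by positivity
  set g : ℝ → ℝ := fun r => PkW m T U r t ^ 2 - 2 * X * 4 ^ n / n * Real.exp (-(n * r)) with hg
  have cW := h.cW1 t
  have mono : MonotoneOn g (Ici 1) := by
    apply monotoneOn_of_hasDerivWithinAt_nonneg (convex_Ici 1)
      (f' := fun r => -2 * (PkM n U r t * PkW m T U r t) / Real.sinh r ^ n
        + 2 * X * 4 ^ n * Real.exp (-(n * r)))
    · exact Continuous.continuousOn (by simp only [hg]; fun_prop)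
    · intro s hs
      rw [interior_Ici] at hs
      have hs0 : 0 < s := by linarith [mem_Ioi.1 hs]
      have d1 := (h.derivW htI hs0).pow 2
      have d2 := ((((hasDerivAt_id s).const_mul (n:ℝ)).neg).exp).const_mul (2 * X * 4 ^ n / n)
      refine (HasDerivAt.congr_deriv (d1.sub d2) ?_).hasDerivWithinAt
      simp only [id_eq]
      field_simp
      norm_num
      ring
    · intro s hs
      rw [interior_Ici] at hs
      have hs1 : 1 ≤ s := le_of_lt hs
      have hs0 : 0 < s := by linarith
      have b1 := hb t ht s hs0.le
      have p := sinhn_pos (n := n) hs0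
      have b2 := le_sinhn (n := n) hs1
      have b3 : PkM n U s t * PkW m T U s t / Real.sinh s ^ n ≤ X * 4 ^ n * Real.exp (-(n * s)) := by
        rw [div_le_iff₀ p]
        calc _ ≤ X := b1
          _ = X * 4 ^ n * Real.exp (-(n * s)) * (Real.exp (n * s) / 4 ^ n) := by
            rw [Real.exp_neg]; field_simp
          _ ≤ _ := by gcongr
      have : -2 * (PkM n U s t * PkW m T U s t) / Real.sinh s ^ n
        = -2 * (PkM n U s t * PkW m T U s t / Real.sinh s ^ n) := by ring
      rw [this]
      linarith
  have lim : Tendsto g atTop (𝓝 0) := by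
    have l1 := (h.W_tendsto htI).pow 2
    have l2 : Tendsto (fun r : ℝ => Real.exp (-(n * r))) atTop (𝓝 0) := by
      apply Real.tendsto_exp_neg_atTop_nhds_zero.comp
      exact (tendsto_id.const_mul_atTop hn)
    simpa [hg] using l1.sub (l2.const_mul (2 * X * 4 ^ n / n))
  have hle := nonpos_of_mono mono lim hr
  have hsq : PkW m T U r t ^ 2 ≤
      (Real.sqrt (2 * E * 4 ^ n / n) * (T - t) ^ (1 / (1 - m)) * Real.exp (-(n * r / 2))) ^ 2 := by
    rw [mul_pow, mul_pow, Real.sq_sqrt (by positivity), ← sqrtT hTt, ← Real.exp_nat_mul]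
    simp only [hg, hX] at hle
    have e : ((2:ℕ):ℝ) * (-(n * r / 2)) = -(n * r) := by push_cast; ring
    rw [e]
    calc _ ≤ _ := sub_nonpos.1 hle
      _ = _ := by ring
  exact le_of_sq_le_sq hsq (by positivity)
where
  le_of_sq_le_sq {a b : ℝ} (h : a ^ 2 ≤ b ^ 2) (hb : 0 ≤ b) : a ≤ b := abs_le_of_sq_le_sq' h hb |>.2

lemma inner (h : Pk n m T U vr ut) {t0 : ℝ} (ht0 : t0 ∈ Ioo 0 T) {γ : ℝ} (hγ : 0 < γ)
    (hγn : (n:ℝ) ≤ 2 * γ + 1) :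
    ∃ C > 0, ∀ t ∈ Ico t0 T, ∀ r ∈ Ioc (0:ℝ) 1,
      PkW m T U r t ≤ C * (T - t) ^ (1 / (1 - m)) * r ^ (-γ) := by
  obtain ⟨E, hE, hb⟩ := h.energy ht0
  obtain ⟨C1, hC1, hb1⟩ := h.outer ht0
  have hn : (0:ℝ) < n := by exact_mod_cast h.hn
  refine ⟨Real.sqrt (C1 ^ 2 + E / γ), by positivity, fun t ht r hr => ?_⟩
  have htI : t ∈ Ioo 0 T := ⟨ht0.1.trans_le ht.1, ht.2⟩
  have hTt : 0 < T - t := by linarith [ht.2]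
  set X := E * (T - t) ^ (2 / (1 - m)) with hX
  have hX0 : 0 < X := by positivity
  set g : ℝ → ℝ := fun r => PkW m T U r t ^ 2 - X / γ * r ^ (-(2 * γ)) with hg
  have cW := h.cW1 t
  have mono : MonotoneOn g (Ioc 0 1) := by
    apply monotoneOn_of_hasDerivWithinAt_nonneg (convex_Ioc 0 1)
      (f' := fun r => -2 * (PkM n U r t * PkW m T U r t) / Real.sinh r ^ n
        + 2 * X * r ^ (-(2 * γ) - 1))
    · simp only [hg]
      refine (cW.pow 2).continuousOn.sub (continuousOn_const.mul ?_)
      exact continuousOn_id.rpow_const (fun x hx => Or.inl hx.1.ne')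
    · intro s hs
      rw [interior_Ioc] at hs
      have hs0 : 0 < s := hs.1
      have d1 := (h.derivW htI hs0).pow 2
      have d2 := (Real.hasDerivAt_rpow_const (p := -(2 * γ)) (Or.inl hs0.ne')).const_mul (X / γ)
      refine (HasDerivAt.congr_deriv (d1.sub d2) ?_).hasDerivWithinAt
      field_simp
      norm_num
      ring
    · intro s hs
      rw [interior_Ioc] at hs
      have hs0 : 0 < s := hs.1
      have b1 := hb t ht s hs0.le
      have p := sinhn_pos (n := n) hs0
      have b2 : s ^ (2 * γ + 1) ≤ Real.sinh s ^ n := by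
        calc s ^ (2 * γ + 1) ≤ s ^ (n:ℝ) := Real.rpow_le_rpow_of_exponent_ge hs0 hs.2.le hγn
          _ = s ^ n := Real.rpow_natCast _ _
          _ ≤ _ := pow_le_pow_left₀ hs0.le (Real.self_le_sinh_iff.2 hs0.le) n
      have b3 : PkM n U s t * PkW m T U s t / Real.sinh s ^ n ≤ X * s ^ (-(2 * γ) - 1) := by
        rw [div_le_iff₀ p]
        calc _ ≤ X := b1
          _ = X * s ^ (-(2 * γ) - 1) * s ^ (2 * γ + 1) := by
            rw [mul_assoc, ← Real.rpow_add hs0]; ring_nf; simp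
          _ ≤ _ := by gcongr
      have : -2 * (PkM n U s t * PkW m T U s t) / Real.sinh s ^ n
        = -2 * (PkM n U s t * PkW m T U s t / Real.sinh s ^ n) := by ring
      rw [this]
      linarith
  have hle := mono hr ⟨one_pos, le_rfl⟩ hr.2
  have hW1 : PkW m T U 1 t ≤ C1 * (T - t) ^ (1 / (1 - m)) := by
    refine (hb1 t ht 1 le_rfl).trans ?_
    apply mul_le_of_le_one_right (by positivity)
    rw [Real.exp_le_one_iff]; simp; positivity
  have hW1' : PkW m T U 1 t ^ 2 ≤ C1 ^ 2 * (T - t) ^ (2 / (1 - m)) := by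
    rw [sqrtT hTt, ← mul_pow]
    exact pow_le_pow_left₀ (h.W_nonneg 1 ht.2.le) hW1 2
  have hr1 : 1 ≤ r ^ (-(2 * γ)) := Real.one_le_rpow_of_pos_of_le_one_of_nonpos hr.1 hr.2 (by linarith)
  have hsq : PkW m T U r t ^ 2 ≤
      (Real.sqrt (C1 ^ 2 + E / γ) * (T - t) ^ (1 / (1 - m)) * r ^ (-γ)) ^ 2 := by
    have er : (r ^ (-γ)) ^ 2 = r ^ (-(2 * γ)) := by
      rw [← Real.rpow_natCast, ← Real.rpow_mul hr.1.le]; congr 1; push_cast; ring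
    rw [mul_pow, mul_pow, Real.sq_sqrt (by positivity), ← sqrtT hTt, er]
    simp only [hg] at hle
    have z1 : 0 ≤ X / γ * (1:ℝ) ^ (-(2 * γ)) := by positivity
    have z2 : C1 ^ 2 * (T - t) ^ (2 / (1 - m)) * 1 ≤ C1 ^ 2 * (T - t) ^ (2 / (1 - m)) * r ^ (-(2 * γ)) := by
      gcongr
    calc _ ≤ C1 ^ 2 * (T - t) ^ (2 / (1 - m)) * r ^ (-(2 * γ)) + X / γ * r ^ (-(2 * γ)) := by linarith
      _ = _ := by rw [hX]; ring
  have hr0 := hr.1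
  exact (abs_le_of_sq_le_sq' hsq (by positivity)).2

end Pk

namespace Pk
variable {n : ℕ} {m T : ℝ} {U vr ut : ℝ → ℝ → ℝ}

lemma back (h : Pk n m T U vr ut) {t0 t1 : ℝ} (ht0 : 0 < t0) (h01 : t0 < t1) (h1T : t1 < T) :
    ∃ κ > 0, ∀ t ∈ Ico t1 T, ∃ t' ∈ Ico t0 T, t' ≤ t ∧ ∀ r ≥ 0, ∀ D,
      PkW m T U r t' ≤ D * (T - t') ^ (1 / (1 - m)) →
      U r t ^ m ≤ κ * D * (T - t) ^ (m / (1 - m)) := by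
  have hm1 := h.hm1
  have h1m : 0 < 1 - m := by linarith
  set δ := (t1 - t0) / (T - t1) with hδ
  have hδ0 : 0 < δ := div_pos (by linarith) (by linarith)
  have hδe : δ * (T - t1) = t1 - t0 := by
    rw [hδ]; exact div_mul_cancel₀ _ (by linarith)
  refine ⟨(1 + δ) ^ (1 / (1 - m)) / ((1 - m) * δ), by positivity, fun t ht => ?_⟩
  have hTt : 0 < T - t := by linarith [ht.2]
  have hlt : t - δ * (T - t) < t := by nlinarith
  have hge : t0 ≤ t - δ * (T - t) := by
    have : δ * (T - t) ≤ δ * (T - t1) := by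
      apply mul_le_mul_of_nonneg_left _ hδ0.le; linarith [ht.1]
    linarith [ht.1]
  refine ⟨t - δ * (T - t), ⟨hge, hlt.trans ht.2⟩, hlt.le, fun r hr D hD => ?_⟩
  have hs := h.smoothing (ht0.trans_le hge) hlt ht.2 hr
  have hW := h.W_nonneg r ht.2.le
  have e1 : T - (t - δ * (T - t)) = (1 + δ) * (T - t) := by ring
  have e2 : t - (t - δ * (T - t)) = δ * (T - t) := by ring
  rw [e1, Real.mul_rpow (by positivity) hTt.le] at hD
  rw [e2] at hs
  have e3 : (T - t) ^ (1 / (1 - m)) = (T - t) ^ (m / (1 - m)) * (T - t) := by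
    rw [← Real.rpow_add_one hTt.ne']
    congr 1
    field_simp; ring
  rw [e3] at hD
  have h5 : (1 - m) * (δ * (T - t)) * U r t ^ m ≤
      D * ((1 + δ) ^ (1 / (1 - m)) * ((T - t) ^ (m / (1 - m)) * (T - t))) := by linarith
  have h6 : U r t ^ m ≤ D * ((1 + δ) ^ (1 / (1 - m)) * ((T - t) ^ (m / (1 - m)) * (T - t))) /
      ((1 - m) * (δ * (T - t))) := by
    rw [le_div_iff₀ (by positivity)]; linarith
  refine h6.trans_eq ?_
  field_simp

lemma Wstep (h : Pk n m T U vr ut) {t0 : ℝ} (ht0 : t0 ∈ Ioo 0 T) {γ : ℝ} (hγ : 0 < γ)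
    (hγn : (n:ℝ) ≤ 2 * γ + 1) :
    ∃ C > 0, ∀ t ∈ Ico t0 T, ∀ β ≥ 1, (∀ r ∈ Icc (0:ℝ) 1, U r t ^ m ≤ β * (T - t) ^ (m / (1 - m))) →
      ∀ r ≥ 0, PkW m T U r t ≤ C * β ^ (γ / (m * (γ + 2))) * (T - t) ^ (1 / (1 - m)) := by
  obtain ⟨C, hC, hb⟩ := h.inner ht0 hγ hγn
  have hm0 := h.hm0
  have hm1 := h.hm1
  have h1m : 0 < 1 - m := by linarith
  refine ⟨C + 1, by positivity, fun t ht β hβ hV r hr => ?_⟩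
  have htI : t ∈ Ioo 0 T := ⟨ht0.1.trans_le ht.1, ht.2⟩
  have hTt : 0 < T - t := by linarith [ht.2]
  have hβ0 : 0 < β := by linarith
  set B := β ^ (1 / m) * (T - t) ^ (1 / (1 - m)) with hB
  have hB0 : 0 < B := by positivity
  have hU : ∀ s ∈ Icc (0:ℝ) 1, U s t ≤ B := by
    intro s hs
    rw [h.U_eq]
    have := Real.rpow_le_rpow (h.nonnegV s t) (hV s hs) (z := 1 / m) (by positivity)
    rw [Real.mul_rpow hβ0.le (by positivity), ← Real.rpow_mul hTt.le] at this
    refine this.trans_eq ?_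
    rw [hB]; congr 2; field_simp
  have hM : ∀ s ∈ Icc (0:ℝ) 1, PkM n U s t ≤ s * (Real.sinh s ^ n * B) := by
    intro s hs
    apply h.M_le hs.1
    intro σ hσ
    apply mul_le_mul _ (hU σ ⟨hσ.1, hσ.2.trans hs.2⟩) (h.nonneg _ _)
      (pow_nonneg (Real.sinh_nonneg_iff.2 hs.1) n)
    exact pow_le_pow_left₀ (Real.sinh_nonneg_iff.2 hσ.1) (Real.sinh_le_sinh.2 hσ.2) n
  have mono : MonotoneOn (fun s => PkW m T U s t + B * s ^ 2 / 2) (Icc 0 1) := by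
    have cW := h.cW1 t
    apply monotoneOn_of_hasDerivWithinAt_nonneg (convex_Icc 0 1)
      (f' := fun s => -(PkM n U s t / Real.sinh s ^ n) + B * s)
    · exact Continuous.continuousOn (by fun_prop)
    · intro s hs
      rw [interior_Icc] at hs
      have d := (h.derivW htI hs.1).add ((((hasDerivAt_id s).pow 2).const_mul B).div_const 2)
      refine (HasDerivAt.congr_deriv d ?_).hasDerivWithinAt
      simp
      ring
    · intro s hs
      rw [interior_Icc] at hs
      have p := sinhn_pos (n := n) hs.1
      have : PkM n U s t / Real.sinh s ^ n ≤ B * s := by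
        rw [div_le_iff₀ p]
        linarith [hM s ⟨hs.1.le, hs.2.le⟩]
      linarith
  set r0 := β ^ (-(1 / (m * (γ + 2)))) with hr0
  have hr0p : 0 < r0 := by positivity
  have hr01 : r0 ≤ 1 := Real.rpow_le_one_of_one_le_of_nonpos hβ (by simp; positivity)
  have h1 := mono ⟨le_rfl, zero_le_one⟩ ⟨hr0p.le, hr01⟩ hr0p.le
  have h2 := hb t ht r0 ⟨hr0p, hr01⟩
  have h3 := h.W_anti_r htI (show (0:ℝ) ∈ Ici 0 by simp) hr hr
  simp only at h1 h3
  have e1 : r0 ^ (-γ) = β ^ (γ / (m * (γ + 2))) := by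
    rw [hr0, ← Real.rpow_mul hβ0.le]; congr 1; field_simp
  have e2 : β ^ (1 / m) * r0 ^ 2 = β ^ (γ / (m * (γ + 2))) := by
    rw [hr0, ← Real.rpow_natCast, ← Real.rpow_mul hβ0.le, ← Real.rpow_add hβ0]
    congr 1; push_cast; field_simp; ring
  rw [e1] at h2
  have e3 : B * r0 ^ 2 = β ^ (γ / (m * (γ + 2))) * (T - t) ^ (1 / (1 - m)) := by
    rw [← e2, hB]; ring
  rw [e3] at h1
  have h4 : 0 < β ^ (γ / (m * (γ + 2))) * (T - t) ^ (1 / (1 - m)) := by positivity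
  nlinarith

lemma supb (h : Pk n m T U vr ut) {t1 : ℝ} (ht1 : t1 ∈ Ioo 0 T) {γ : ℝ} (hγ : 0 < γ)
    (hγn : (n:ℝ) ≤ 2 * γ + 1) (hγm : γ < m * (γ + 2)) :
    ∃ C > 0, ∀ t ∈ Ico t1 T, ∀ r ∈ Icc (0:ℝ) 1, U r t ^ m ≤ C * (T - t) ^ (m / (1 - m)) := by
  have hm0 := h.hm0
  have hm1 := h.hm1
  have h1m : 0 < 1 - m := by linarith
  have ht0 : t1 / 2 ∈ Ioo 0 T := ⟨by linarith [ht1.1], by linarith [ht1.1, ht1.2]⟩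
  obtain ⟨κ, hκ, hback⟩ := h.back ht0.1 (by linarith [ht1.1] : t1 / 2 < t1) ht1.2
  obtain ⟨C, hC, hW⟩ := h.Wstep ht0 hγ hγn
  obtain ⟨K, hK0, hK⟩ := h.expdecay ht0
  set t0 := t1 / 2 with ht0e
  have h01 : t0 < t1 := by linarith [ht1.1]
  set b := γ / (m * (γ + 2)) with hb
  have hb1 : b < 1 := by rw [hb, div_lt_one (by positivity)]; exact hγm
  set μ := m / (1 - m) with hμ
  have hμ0 : 0 < μ := by positivity
  have hT1 : 0 < T - t1 := by linarith [ht1.2]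
  set K0 := K / (T - t1) ^ μ with hK0e
  have hK00 : 0 < K0 := by positivity
  refine ⟨1 + K0 + (κ * C) ^ (1 / (1 - b)), by positivity, fun t ht r hr => ?_⟩
  have hTt : 0 < T - t := by linarith [ht.2]
  set f : ℝ × ℝ → ℝ := fun p => U p.1 p.2 ^ m / (T - p.2) ^ μ with hf
  have cf : ContinuousOn f (Icc 0 1 ×ˢ Icc t0 t) := by
    apply h.contV.continuousOn.div
    · apply ContinuousOn.rpow_const
      · fun_prop
      · intro p hp; exact Or.inr hμ0.le
    · intro p hp
      have : 0 < T - p.2 := by linarith [hp.2.2]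
      positivity
  have hrt : (r, t) ∈ Icc (0:ℝ) 1 ×ˢ Icc t0 t := ⟨hr, h01.le.trans ht.1, le_rfl⟩
  obtain ⟨p, hp, hmax⟩ := (isCompact_Icc.prod isCompact_Icc).exists_isMaxOn ⟨_, hrt⟩ cf
  set β := max 1 (f p) with hβ
  have hβ1 : 1 ≤ β := le_max_left _ _
  have hβ0 : 0 < β := by linarith
  have hall : ∀ s ∈ Icc t0 t, ∀ x ∈ Icc (0:ℝ) 1, U x s ^ m ≤ β * (T - s) ^ μ := by
    intro s hs x hx
    have hTs : 0 < T - s := by linarith [hs.2]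
    have h1 : f (x, s) ≤ β := (hmax ⟨hx, hs⟩).trans (le_max_right _ _)
    simp only [hf] at h1
    rwa [div_le_iff₀ (by positivity)] at h1
  have hβle : β ≤ 1 + K0 + (κ * C) ^ (1 / (1 - b)) := by
    have z : 0 < (κ * C) ^ (1 / (1 - b)) := by positivity
    rcases le_or_gt (f p) 1 with h1 | h1
    · rw [hβ, max_eq_left h1]; linarith
    have hβe : β = f p := max_eq_right h1.le
    have hTp : 0 < T - p.2 := by linarith [hp.2.2]
    rcases le_or_gt p.2 t1 with h2 | h2
    · have : f p ≤ K0 := by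
        simp only [hf, hK0e]
        have k1 : U p.1 p.2 ^ m ≤ K := by
          refine (hK p.1 hp.1.1 p.2 ⟨hp.2.1, by linarith⟩).trans ?_
          apply mul_le_of_le_one_right hK0.le
          rw [Real.exp_le_one_iff]
          have := hp.1.1
          simp; positivity
        gcongr
      linarith
    · obtain ⟨t', ht', htt, hD⟩ := hback p.2 ⟨h2.le, by linarith⟩
      have w := hW t' ht' β hβ1 (hall t' ⟨ht'.1, htt.trans hp.2.2⟩) p.1 hp.1.1
      have w2 := hD p.1 hp.1.1 _ w
      rw [← div_le_iff₀ (by positivity)] at w2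
      have w3 : β ≤ κ * (C * β ^ b) := by
        rw [hβe] at w2 ⊢
        exact w2
      have w4 : β ^ (1 - b) ≤ κ * C := by
        rw [Real.rpow_sub hβ0, Real.rpow_one, div_le_iff₀ (by positivity)]
        linarith
      have w5 := Real.rpow_le_rpow (by positivity) w4 (z := 1 / (1 - b))
        (by have : 0 < 1 - b := by linarith
            positivity)
      rw [← Real.rpow_mul hβ0.le, mul_one_div_cancel (by linarith), Real.rpow_one] at w5
      linarith
  refine (hall t hrt.2 r hr).trans ?_
  gcongr

end Pk

namespace Pk
variable {n : ℕ} {m T : ℝ} {U vr ut : ℝ → ℝ → ℝ}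

def PP (n : ℕ) (m T : ℝ) (U : ℝ → ℝ → ℝ) (β : ℝ) : Prop :=
  ∀ t1 ∈ Ioo 0 T, ∃ C > 0, ∀ t ∈ Ico t1 T, ∀ r ≥ 0,
    U r t ^ m ≤ C * (T - t) ^ (m / (1 - m)) * Real.exp (-(β * n * r))

lemma PP_mono {β β' : ℝ} (h : PP n m T U β) (hb : β' ≤ β) : PP n m T U β' := by
  intro t1 ht1
  obtain ⟨C, hC, hb'⟩ := h t1 ht1
  refine ⟨C, hC, fun t ht r hr => (hb' t ht r hr).trans ?_⟩
  have : 0 < T - t := by linarith [ht.2]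
  gcongr

lemma PP_of_W (h : Pk n m T U vr ut) {γ : ℝ} (hγ : 0 < γ)
    (hγn : (n:ℝ) ≤ 2 * γ + 1) (hγm : γ < m * (γ + 2)) {β : ℝ} (hβ : 0 < β)
    (hW : ∀ t1 ∈ Ioo 0 T, ∃ C > 0, ∀ t ∈ Ico t1 T, ∀ r ≥ 1,
      PkW m T U r t ≤ C * (T - t) ^ (1 / (1 - m)) * Real.exp (-(β * n * r))) :
    PP n m T U β := by
  intro t1 ht1
  have ht0 : t1 / 2 ∈ Ioo 0 T := ⟨by linarith [ht1.1], by linarith [ht1.1, ht1.2]⟩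
  obtain ⟨κ, hκ, hback⟩ := h.back ht0.1 (by linarith [ht1.1] : t1 / 2 < t1) ht1.2
  obtain ⟨C, hC, hWC⟩ := hW _ ht0
  obtain ⟨S, hS, hSb⟩ := h.supb ht1 hγ hγn hγm
  refine ⟨κ * C + S * Real.exp (β * n), by positivity, fun t ht r hr => ?_⟩
  have hTt : 0 < T - t := by linarith [ht.2]
  rcases le_total r 1 with hr1 | hr1
  · refine (hSb t ht r ⟨hr, hr1⟩).trans ?_
    have e1 : 1 ≤ Real.exp (β * n) * Real.exp (-(β * n * r)) := by
      rw [← Real.exp_add]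
      apply Real.one_le_exp
      have : 0 ≤ β * n := by positivity
      nlinarith
    calc S * (T - t) ^ (m / (1 - m)) ≤
        S * (T - t) ^ (m / (1 - m)) * (Real.exp (β * n) * Real.exp (-(β * n * r))) :=
          le_mul_of_one_le_right (by positivity) e1
      _ ≤ κ * C * (T - t) ^ (m / (1 - m)) * Real.exp (-(β * n * r)) + 
        S * (T - t) ^ (m / (1 - m)) * (Real.exp (β * n) * Real.exp (-(β * n * r))) :=
          le_add_of_nonneg_left (by positivity)
      _ = _ := by ring
  · obtain ⟨t', ht', -, hD⟩ := hback t ht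
    have w := hWC t' ht' r hr1
    have w2 := hD r hr (C * Real.exp (-(β * n * r))) (w.trans_eq (by ring))
    calc _ ≤ _ := w2
      _ ≤ κ * (C * Real.exp (-(β * n * r))) * (T - t) ^ (m / (1 - m)) +
        S * (T - t) ^ (m / (1 - m)) * (Real.exp (β * n) * Real.exp (-(β * n * r))) :=
          le_add_of_nonneg_right (by positivity)
      _ = _ := by ring

lemma PP_half (h : Pk n m T U vr ut) {γ : ℝ} (hγ : 0 < γ)
    (hγn : (n:ℝ) ≤ 2 * γ + 1) (hγm : γ < m * (γ + 2)) : PP n m T U (1 / 2) := by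
  apply h.PP_of_W hγ hγn hγm (by norm_num)
  intro t1 ht1
  obtain ⟨C, hC, hb⟩ := h.outer ht1
  refine ⟨C, hC, fun t ht r hr => (hb t ht r hr).trans_eq ?_⟩
  congr 2; ring

lemma PP_step (h : Pk n m T U vr ut) {γ : ℝ} (hγ : 0 < γ)
    (hγn : (n:ℝ) ≤ 2 * γ + 1) (hγm : γ < m * (γ + 2)) {β : ℝ} (hβ : 0 < β) (hβm : β ≠ m)
    (hP : PP n m T U β) : PP n m T U (min (β / m) 1) := by
  have hm0 := h.hm0
  have hm1 := h.hm1
  have h1m : 0 < 1 - m := by linarith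
  have hn : (0:ℝ) < n := by exact_mod_cast h.hn
  have hb0 : 0 < min (β / m) 1 := lt_min (by positivity) one_pos
  apply h.PP_of_W hγ hγn hγm hb0
  set β' := min (β / m) 1 with hβ'
  intro t1 ht1
  obtain ⟨C, hC, hb⟩ := hP t1 ht1
  set c := n * (1 - β / m) with hc
  have hc0 : c ≠ 0 := by
    apply mul_ne_zero hn.ne'
    intro h0
    apply hβm
    field_simp at h0
    linarith
  set D := C ^ (1 / m) / |c| with hD
  have hD0 : 0 < D := by have := abs_pos.2 hc0; positivity
  refine ⟨D * 4 ^ n / (n * β'), by positivity, fun t ht r hr => ?_⟩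
  have htI : t ∈ Ioo 0 T := ⟨ht1.1.trans_le ht.1, ht.2⟩
  have hTt : 0 < T - t := by linarith [ht.2]
  set E := (T - t) ^ (1 / (1 - m)) with hE
  have hE0 : 0 < E := by positivity
  have hU : ∀ s ≥ 0, Real.sinh s ^ n * U s t ≤ C ^ (1 / m) * E * Real.exp (c * s) := by
    intro s hs
    have h1 := h.U_le (by positivity) (hb t ht s hs)
    rw [Real.mul_rpow hC.le (by positivity), ← Real.rpow_mul hTt.le,
      show m / (1 - m) * (1 / m) = 1 / (1 - m) by field_simp, ← hE] at h1
    calc _ ≤ Real.exp (n * s) * (C ^ (1 / m) * E * Real.exp (-(β * n * s / m))) :=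
          mul_le_mul (sinhn_le' hs) h1 (h.nonneg _ _) (Real.exp_pos _).le
      _ = C ^ (1 / m) * E * (Real.exp (n * s) * Real.exp (-(β * n * s / m))) := by ring
      _ = _ := by
        rw [← Real.exp_add]; congr 2; rw [hc]; ring
  have hM : ∀ s ≥ 0, PkM n U s t ≤ D * E * Real.exp (n * (1 - β') * s) := by
    intro s hs
    have mono : MonotoneOn (fun s => C ^ (1 / m) * E / c * Real.exp (c * s) - PkM n U s t) (Ici 0) := by
      have cM := h.cM1 t
      apply monotoneOn_of_hasDerivWithinAt_nonneg (convex_Ici 0)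
        (f' := fun s => C ^ (1 / m) * E * Real.exp (c * s) - Real.sinh s ^ n * U s t)
      · exact Continuous.continuousOn (by fun_prop)
      · intro x hx
        have d := ((((hasDerivAt_id x).const_mul c).exp).const_mul (C ^ (1 / m) * E / c)).sub
          (h.derivM x t)
        refine (HasDerivAt.congr_deriv d ?_).hasDerivWithinAt
        simp only [id_eq]
        field_simp
      · intro x hx
        rw [interior_Ici] at hx
        linarith [hU x (le_of_lt hx)]
    have h1 := mono (show (0:ℝ) ∈ Ici 0 by simp) hs hs
    have hM0 : PkM n U 0 t = 0 := by simp [PkM]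
    simp only [hM0, mul_zero, Real.exp_zero, mul_one, sub_zero] at h1
    have h2 : PkM n U s t ≤ C ^ (1 / m) * E * ((Real.exp (c * s) - 1) / c) := by
      have : C ^ (1 / m) * E * ((Real.exp (c * s) - 1) / c) =
        C ^ (1 / m) * E / c * Real.exp (c * s) - C ^ (1 / m) * E / c := by ring
      linarith
    refine h2.trans ?_
    have h3 : (Real.exp (c * s) - 1) / c ≤ Real.exp (n * (1 - β') * s) / |c| := by
      rcases lt_or_gt_of_ne hc0 with hneg | hpos
      · have hb1 : β' = 1 := by
          rw [hβ']; apply min_eq_right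
          by_contra hcon
          push Not at hcon
          have : 0 < c := by rw [hc]; apply mul_pos hn; linarith
          linarith
        rw [hb1, abs_of_neg hneg]
        simp only [sub_self, mul_zero, zero_mul, Real.exp_zero]
        rw [← neg_div_neg_eq]
        apply div_le_div_of_nonneg_right _ (by linarith)
        linarith [Real.exp_pos (c * s)]
      · have hb1 : β' = β / m := by
          rw [hβ']; apply min_eq_left
          by_contra hcon
          push Not at hcon
          have : c < 0 := by rw [hc]; apply mul_neg_of_pos_of_neg hn; linarith
          linarith
        rw [hb1, abs_of_pos hpos, ← hc]
        apply div_le_div_of_nonneg_right _ hpos.le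
        linarith
    calc _ ≤ C ^ (1 / m) * E * (Real.exp (n * (1 - β') * s) / |c|) := by gcongr
      _ = _ := by rw [hD]; ring
  set G := D * E * 4 ^ n with hG
  have hG0 : 0 < G := by positivity
  have mono : MonotoneOn (fun s => PkW m T U s t - G / (n * β') * Real.exp (-(n * β' * s))) (Ici 1) := by
    have cW := h.cW1 t
    apply monotoneOn_of_hasDerivWithinAt_nonneg (convex_Ici 1)
      (f' := fun s => -(PkM n U s t / Real.sinh s ^ n) + G * Real.exp (-(n * β' * s)))
    · exact Continuous.continuousOn (by fun_prop)
    · intro s hs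
      rw [interior_Ici] at hs
      have hs0 : 0 < s := by linarith [mem_Ioi.1 hs]
      have d := (h.derivW htI hs0).sub
        (((((hasDerivAt_id s).const_mul (n * β')).neg).exp).const_mul (G / (n * β')))
      refine (HasDerivAt.congr_deriv d ?_).hasDerivWithinAt
      simp only [id_eq, Pi.neg_apply]
      field_simp
      ring
    · intro s hs
      rw [interior_Ici] at hs
      have hs1 : 1 ≤ s := le_of_lt hs
      have hs0 : 0 < s := by linarith
      have p := sinhn_pos (n := n) hs0
      have b2 := le_sinhn (n := n) hs1
      have : PkM n U s t / Real.sinh s ^ n ≤ G * Real.exp (-(n * β' * s)) := by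
        rw [div_le_iff₀ p]
        calc _ ≤ _ := hM s hs0.le
          _ = D * E * (Real.exp (-(n * β' * s)) * Real.exp (n * s)) := by
            rw [← Real.exp_add]; congr 2; ring
          _ = G * Real.exp (-(n * β' * s)) * (Real.exp (n * s) / 4 ^ n) := by
            rw [hG]; field_simp
          _ ≤ _ := by gcongr
      linarith
  have lim : Tendsto (fun s => PkW m T U s t - G / (n * β') * Real.exp (-(n * β' * s))) atTop (𝓝 0) := by
    have l2 : Tendsto (fun r : ℝ => Real.exp (-(n * β' * r))) atTop (𝓝 0) := by
      apply Real.tendsto_exp_neg_atTop_nhds_zero.comp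
      exact (tendsto_id.const_mul_atTop (by positivity))
    simpa using (h.W_tendsto htI).sub (l2.const_mul (G / (n * β')))
  have := nonpos_of_mono mono lim hr
  refine (sub_nonpos.1 this).trans_eq ?_
  rw [hG, mul_comm (n:ℝ) β']
  ring

lemma PP_one (h : Pk n m T U vr ut) {γ : ℝ} (hγ : 0 < γ)
    (hγn : (n:ℝ) ≤ 2 * γ + 1) (hγm : γ < m * (γ + 2)) : PP n m T U 1 := by
  have hm0 := h.hm0
  have hm1 := h.hm1
  have ind : ∀ k : ℕ, ∀ β ∈ Ioo (0:ℝ) 1, β * m ^ k ≤ 1 / 2 → PP n m T U β := by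
    intro k
    induction k with
    | zero =>
      intro β hβ hle
      exact PP_mono (h.PP_half hγ hγn hγm) (by simpa using hle)
    | succ k ih =>
      intro β hβ hle
      have hβ0 := hβ.1
      have h1 := ih (β * m) ⟨by positivity, by nlinarith [hβ.1, hβ.2]⟩ (by
        rw [pow_succ] at hle; linarith)
      have h2 := h.PP_step hγ hγn hγm (by positivity) (by nlinarith [hβ.1, hβ.2]) h1
      rw [mul_div_cancel_right₀ _ hm0.ne', min_eq_left hβ.2.le] at h2
      exact h2
  obtain ⟨k, hk⟩ := exists_pow_lt_of_lt_one (show (0:ℝ) < 1 / 2 by norm_num) hm1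
  have h3 := ind k ((1 + m) / 2) ⟨by linarith, by linarith⟩ (by
    have : 0 < m ^ k := by positivity
    nlinarith)
  have h4 := h.PP_step hγ hγn hγm (by linarith) (by linarith) h3
  rw [min_eq_right] at h4
  · exact h4
  · rw [le_div_iff₀ hm0]; linarith

end Pk


noncomputable def PkU (T : ℝ) (u : ℝ → ℝ → ℝ) (r t : ℝ) : ℝ := u (max r 0) (max 0 (min t T))

lemma PkU_eq {T : ℝ} {u : ℝ → ℝ → ℝ} {r t : ℝ} (hr : 0 ≤ r) (ht : t ∈ Icc 0 T) :
    PkU T u r t = u r t := by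
  rw [PkU, max_eq_left hr, min_eq_left ht.2, max_eq_right ht.1]

namespace Pk

lemma decay_of_H1 {k : ℕ} {g : ℝ → ℝ} (hg : ContDiffOn ℝ (⊤ : ℕ∞) g (Ioi 0))
    (hM : MemH1rad (k + 2) g) {r : ℝ} (hr : 0 < r) :
    g r ^ 2 * Real.sinh r ^ (k + 1) ≤ 2 * H1normSq (k + 2) g := by
  obtain ⟨-, i1, i2⟩ := hM
  unfold H1normSq
  simp only [show k + 2 - 1 = k + 1 from rfl] at *
  have hd : ∀ s > 0, HasDerivAt g (deriv g s) s := fun s hs =>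
    ((hg.differentiableOn (by simp)).differentiableAt (Ioi_mem_nhds hs)).hasDerivAt
  have cg : ContinuousOn g (Ioi 0) := hg.continuousOn
  have cd : ContinuousOn (deriv g) (Ioi 0) :=
    (hg.deriv_of_isOpen (m := 0) isOpen_Ioi (by simp)).continuousOn
  have cs : Continuous Real.sinh := Real.continuous_sinh
  have cc : Continuous Real.cosh := Real.continuous_cosh
  set I1 := ∫ s in Ioi (0:ℝ), (g s) ^ 2 * Real.sinh s ^ (k + 1) with hI1
  set I2 := ∫ s in Ioi (0:ℝ), (deriv g s) ^ 2 * Real.sinh s ^ (k + 1) with hI2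
  have sn : ∀ s > 0, 0 ≤ Real.sinh s ^ (k + 1) := fun s hs => (sinhn_pos hs).le
  have key : ∀ b ∈ Icc r (r + 1), g r ^ 2 * Real.sinh r ^ (k + 1) - (I1 + I2) ≤
      g b ^ 2 * Real.sinh b ^ (k + 1) := by
    intro b hb
    have hsub : Icc r b ⊆ Ioi 0 := fun s hs => hr.trans_le hs.1
    have cg' := cg.mono hsub
    have cd' := cd.mono hsub
    have c1 : ContinuousOn (fun s => 2 * g s * deriv g s * Real.sinh s ^ (k + 1)
        + g s ^ 2 * ((k + 1) * Real.sinh s ^ k * Real.cosh s)) (Icc r b) := by fun_prop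
    have c2 : ContinuousOn (fun s => -(g s ^ 2 * Real.sinh s ^ (k + 1)
        + deriv g s ^ 2 * Real.sinh s ^ (k + 1))) (Icc r b) := by fun_prop
    have ftc := intervalIntegral.integral_eq_sub_of_hasDerivAt_of_le (a := r) (b := b)
      (f := fun s => g s ^ 2 * Real.sinh s ^ (k + 1))
      (f' := fun s => 2 * g s * deriv g s * Real.sinh s ^ (k + 1)
        + g s ^ 2 * ((k + 1) * Real.sinh s ^ k * Real.cosh s)) hb.1 (by fun_prop)
      (fun s hs => by
        have d := ((hd s (hr.trans hs.1)).pow 2).mul ((Real.hasDerivAt_sinh s).pow (k + 1))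
        refine HasDerivAt.congr_deriv d ?_
        simp)
      (c1.intervalIntegrable_of_Icc hb.1)
    have le1 := intervalIntegral.integral_mono_on (μ := volume) hb.1
      (c2.intervalIntegrable_of_Icc hb.1) (c1.intervalIntegrable_of_Icc hb.1) (fun s hs => by
        have hs0 : 0 < s := hsub hs
        have p1 := sn s hs0
        have p2 : 0 ≤ g s ^ 2 * ((k + 1) * Real.sinh s ^ k * Real.cosh s) := by
          have := Real.sinh_pos_iff.2 hs0
          have := Real.cosh_pos s
          positivity
        nlinarith [mul_nonneg (sq_nonneg (g s + deriv g s)) p1])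
    rw [ftc, intervalIntegral.integral_neg, intervalIntegral.integral_of_le hb.1] at le1
    have le2 : ∫ s in Ioc r b, (g s ^ 2 * Real.sinh s ^ (k + 1)
        + deriv g s ^ 2 * Real.sinh s ^ (k + 1)) ≤ I1 + I2 := by
      rw [hI1, hI2, ← integral_add i1 i2]
      apply setIntegral_mono_set (i1.add i2)
      · filter_upwards [ae_restrict_mem measurableSet_Ioi] with s hs
        have := sn s hs
        simp only [Pi.zero_apply, Pi.add_apply]
        positivity
      · exact Eventually.of_forall (fun s hs => hr.trans hs.1)
    linarith
  have c0 : ContinuousOn (fun s => g s ^ 2 * Real.sinh s ^ (k + 1)) (Icc r (r + 1)) := by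
    have := cg.mono (fun s (hs : s ∈ Icc r (r + 1)) => hr.trans_le hs.1)
    fun_prop
  have fin := intervalIntegral.integral_mono_on (μ := volume) (by linarith : r ≤ r + 1)
    intervalIntegrable_const (c0.intervalIntegrable_of_Icc (by linarith)) key
  rw [intervalIntegral.integral_const, intervalIntegral.integral_of_le (by linarith)] at fin
  have le3 : ∫ s in Ioc r (r + 1), (g s ^ 2 * Real.sinh s ^ (k + 1)) ≤ I1 := by
    rw [hI1]
    apply setIntegral_mono_set i1
    · filter_upwards [ae_restrict_mem measurableSet_Ioi] with s hs
      have := sn s hs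
      simp only [Pi.zero_apply]
      positivity
    · exact Eventually.of_forall (fun s hs => hr.trans hs.1)
  have I2n : 0 ≤ I2 := by
    apply setIntegral_nonneg measurableSet_Ioi
    intro s hs
    have := sn s hs
    positivity
  simp only [add_sub_cancel_left, one_smul] at fin
  linarith

lemma extract {k : ℕ} {m T : ℝ} (hm0 : 0 < m) (hm1 : m < 1) (hT : 0 < T) {u : ℝ → ℝ → ℝ}
    (hu : IsRadialEnergySolution (k + 2) m T u) :
    ∃ vr ut, Pk (k + 1) m T (PkU T u) vr ut := by
  set S : Set (ℝ × ℝ) := Ici 0 ×ˢ Ioo 0 T with hS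
  have hSu : UniqueDiffOn ℝ S := (uniqueDiffOn_Ici 0).prod isOpen_Ioo.uniqueDiffOn
  set F : ℝ × ℝ → ℝ := fun p => u p.1 p.2 with hF
  set G : ℝ × ℝ → ℝ := fun p => u p.1 p.2 ^ m with hG
  have sF : ContDiffOn ℝ (⊤ : ℕ∞) F S := hu.smooth
  have sG : ContDiffOn ℝ (⊤ : ℕ∞) G S :=
    sF.rpow_const_of_ne (fun p hp => (hu.pos p.1 hp.1 p.2 hp.2).ne')
  have hmm : ∀ t, max 0 (min t T) ∈ Icc 0 T := fun t =>
    ⟨le_max_left _ _, max_le hT.le (min_le_right _ _)⟩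
  have dF : ∀ p ∈ S, HasFDerivWithinAt F (fderivWithin ℝ F S p) S p := fun p hp =>
    ((sF.differentiableOn (by simp)) p hp).hasFDerivWithinAt
  have dG : ∀ p ∈ S, HasFDerivWithinAt G (fderivWithin ℝ G S p) S p := fun p hp =>
    ((sG.differentiableOn (by simp)) p hp).hasFDerivWithinAt
  have hut : ∀ r ≥ 0, ∀ t ∈ Ioo 0 T,
      HasDerivAt (fun t => u r t) (fderivWithin ℝ F S (r, t) (0, 1)) t := by
    intro r hr t ht
    have h1 : HasDerivWithinAt (fun t : ℝ => (r, t)) (0, 1) (Ioo 0 T) t :=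
      ((hasDerivAt_const t r).prodMk (hasDerivAt_id t)).hasDerivWithinAt
    have h2 := (dF (r, t) ⟨hr, ht⟩).comp_hasDerivWithinAt t h1 (fun s hs => ⟨hr, hs⟩)
    exact h2.hasDerivAt (Ioo_mem_nhds ht.1 ht.2)
  have hvr : ∀ r > 0, ∀ t ∈ Ioo 0 T,
      HasDerivAt (fun r => u r t ^ m) (fderivWithin ℝ G S (r, t) (1, 0)) r := by
    intro r hr t ht
    have h1 : HasDerivWithinAt (fun r : ℝ => (r, t)) (1, 0) (Ici 0) r :=
      ((hasDerivAt_id r).prodMk (hasDerivAt_const r t)).hasDerivWithinAt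
    have h2 := (dG (r, t) (mk_mem_prod (mem_Ici.2 (le_of_lt hr)) ht)).comp_hasDerivWithinAt r h1 (fun s hs => mk_mem_prod hs ht)
    exact h2.hasDerivAt (Ici_mem_nhds hr)
  have sg : ∀ t ∈ Ioo 0 T, ContDiffOn ℝ (⊤ : ℕ∞) (fun r => u r t ^ m) (Ioi 0) := by
    intro t ht
    have c1 : ContDiffOn ℝ (⊤ : ℕ∞) (fun r : ℝ => (r, t)) (Ioi 0) :=
      (contDiff_id.prodMk contDiff_const).contDiffOn
    exact sG.comp c1 (fun s hs => mk_mem_prod (mem_Ici.2 (le_of_lt hs)) ht)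
  have Ieq : ∀ t ∈ Ioo 0 T, t ∈ Icc 0 T := fun t ht => ⟨ht.1.le, ht.2.le⟩
  refine ⟨fun r t => fderivWithin ℝ G S (r, t) (1, 0), fun r t => fderivWithin ℝ F S (r, t) (0, 1),
    ⟨by omega, hm0, hm1, hT, ?_, ?_, ?_, ?_, ?_, ?_, ?_, ?_, ?_, ?_⟩⟩
  · exact hu.continuousOn.comp_continuous (f := fun p : ℝ × ℝ => (max p.1 0, max 0 (min p.2 T)))
      (by fun_prop) (fun p => ⟨mem_Ici.2 (le_max_right _ _), hmm _⟩)
  · intro r t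
    exact hu.nonneg _ (mem_Ici.2 (le_max_right _ _)) _ (hmm t)
  · intro r t ht
    have : max 0 (min t T) = t := by rw [min_eq_left ht.2.le, max_eq_right ht.1.le]
    rw [PkU, this]
    exact hu.pos _ (mem_Ici.2 (le_max_right _ _)) _ ht
  · intro r
    rw [PkU, min_self, max_eq_right hT.le]
    exact hu.extinction _ (mem_Ici.2 (le_max_right _ _))
  · exact (sG.continuousOn_fderivWithin hSu (by simp)).clm_apply continuousOn_const
  · exact (sF.continuousOn_fderivWithin hSu (by simp)).clm_apply continuousOn_const
  · intro r hr t ht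
    refine (hvr r hr t ht).congr_of_eventuallyEq ?_
    filter_upwards [Ioi_mem_nhds hr] with s hs
    rw [PkU_eq (le_of_lt hs) (Ieq t ht)]
  · intro r hr t ht
    have hsg := sg t ht
    have hdd : HasDerivAt (deriv fun r => u r t ^ m) (deriv (deriv fun r => u r t ^ m) r) r := by
      have := (hsg.deriv_of_isOpen (m := ((⊤ : ℕ∞) : WithTop ℕ∞)) isOpen_Ioi (by rfl)).differentiableOn (by simp)
      exact (this.differentiableAt (Ioi_mem_nhds hr)).hasDerivAt
    have d := ((Real.hasDerivAt_sinh r).pow (k + 1)).mul hdd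
    have ev : (fun r => Real.sinh r ^ (k + 1) * fderivWithin ℝ G S (r, t) (1, 0)) =ᶠ[𝓝 r]
        (Real.sinh ^ (k + 1) * deriv fun r => u r t ^ m) := by
      filter_upwards [Ioi_mem_nhds hr] with s hs
      simp only [Pi.mul_apply, Pi.pow_apply]
      rw [(hvr s hs t ht).deriv]
    have d2 := d.congr_of_eventuallyEq ev
    refine HasDerivAt.congr_deriv d2 ?_
    have pde := hu.pde r hr t ht
    rw [(hut r (le_of_lt hr) t ht).deriv] at pde
    rw [pde]
    have := (Real.sinh_pos_iff.2 hr).ne'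
    push_cast
    simp only [Nat.add_sub_cancel, Pi.pow_apply]
    field_simp
    ring
  · intro r hr t ht
    refine (hut r hr t ht).congr_of_eventuallyEq ?_
    filter_upwards [Ioo_mem_nhds ht.1 ht.2] with s hs
    rw [PkU_eq hr (Ieq s hs)]
  · intro t0 ht0
    obtain ⟨C, hC⟩ := hu.energy_bdd t0 ht0
    refine ⟨2 * C, fun t ht r hr => ?_⟩
    have htI : t ∈ Ioo 0 T := ⟨ht0.1.trans_le ht.1, ht.2⟩
    rw [PkU_eq (le_of_lt hr) (Ieq t htI)]
    have := decay_of_H1 (sg t htI) (hu.energy t htI) hr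
    linarith [hC t ht]

end Pk

theorem rescaled_upper_bound
    (N : ℕ) (hN : 2 ≤ N) (m T : ℝ)
    (hm : m ∈ Set.Ioo (((N : ℝ) - 2) / ((N : ℝ) + 2)) 1) (hT : 0 < T)
    (u : ℝ → ℝ → ℝ) (hu : IsRadialEnergySolution N m T u) :
    ∀ ε > (0:ℝ), ∃ Q > (0:ℝ), ∀ r ∈ Set.Ici (0:ℝ), ∀ τ ≥ ε,
      rescaled m T u r τ ≤ Q * Real.exp (-((N : ℝ) - 1) * r / m) := by
  intro ε hε
  obtain ⟨k, rfl⟩ := Nat.exists_eq_add_of_le' hN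
  obtain ⟨hm0', hm1⟩ := hm
  push_cast at hm0'
  have hk : (0:ℝ) ≤ k := Nat.cast_nonneg k
  rw [div_lt_iff₀ (by positivity)] at hm0'
  have hm0 : 0 < m := by
    by_contra hcon
    push Not at hcon
    nlinarith
  have h1m : 0 < 1 - m := by linarith
  obtain ⟨vr, ut, h⟩ := Pk.extract hm0 hm1 hT hu
  have hA : (k:ℝ) / 2 < 2 * m / (1 - m) := by
    rw [div_lt_div_iff₀ (by norm_num) h1m]; linarith
  have hB : 0 < 2 * m / (1 - m) := by positivity
  have hP := h.PP_one (γ := ((k:ℝ) / 2 + 2 * m / (1 - m)) / 2) (by positivity)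
    (by push_cast; linarith) (by
      have e : 2 * m / (1 - m) * (1 - m) = 2 * m := div_mul_cancel₀ _ h1m.ne'
      nlinarith)
  have hE : ∀ τ > (0:ℝ), Real.exp (-τ / T) < 1 := by
    intro τ hτ
    rw [Real.exp_lt_one_iff]
    exact div_neg_of_neg_of_pos (by linarith) hT
  have ht1 : T - T * Real.exp (-ε / T) ∈ Ioo 0 T := by
    have h1 := hE ε hε
    have h2 := Real.exp_pos (-ε / T)
    constructor
    · nlinarith
    · have : 0 < T * Real.exp (-ε / T) := by positivity
      linarith
  obtain ⟨C, hC, hb⟩ := hP _ ht1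
  refine ⟨C ^ (1 / m) * T ^ (1 / (1 - m)), by positivity, fun r hr τ hτ => ?_⟩
  have hr0 : 0 ≤ r := hr
  have hτ0 : 0 < τ := by linarith
  set t := T - T * Real.exp (-τ / T) with ht
  have htm : t ∈ Ico (T - T * Real.exp (-ε / T)) T := by
    constructor
    · rw [ht]
      gcongr
    · have : 0 < T * Real.exp (-τ / T) := by positivity
      linarith
  have hTt : T - t = T * Real.exp (-τ / T) := by rw [ht]; ring
  have hu1 := h.U_le (by have : 0 < T - t := by linarith [htm.2]
                         positivity) (hb t htm r hr0)
  rw [PkU_eq hr0 ⟨ht1.1.le.trans htm.1, htm.2.le⟩, hTt, Real.mul_rpow hC.le (by positivity),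
    ← Real.rpow_mul (by positivity), show m / (1 - m) * (1 / m) = 1 / (1 - m) by field_simp,
    Real.mul_rpow hT.le (by positivity), ← Real.exp_mul] at hu1
  unfold rescaled
  rw [← ht]
  calc _ ≤ Real.exp (τ / ((1 - m) * T)) * (C ^ (1 / m) *
        (T ^ (1 / (1 - m)) * Real.exp (-τ / T * (1 / (1 - m)))) *
          Real.exp (-(1 * ((k + 1 : ℕ) : ℝ) * r / m))) := by gcongr
    _ = C ^ (1 / m) * T ^ (1 / (1 - m)) * (Real.exp (τ / ((1 - m) * T)) *
        Real.exp (-τ / T * (1 / (1 - m)))) * Real.exp (-(1 * ((k + 1 : ℕ) : ℝ) * r / m)) := by ring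
    _ = _ := by
      rw [← Real.exp_add]
      have e1 : τ / ((1 - m) * T) + -τ / T * (1 / (1 - m)) = 0 := by field_simp; ring
      rw [e1, Real.exp_zero, mul_one]
      congr 2
      push_cast
      ring
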